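/- arXiv:1510.07190 — 2 statements merged into one kernel-verified Lean document; each statement's English description precedes it below -/
import Mathlib

section
/- Let τ = 1324 ∈ S_4. Then U_{τ,1}(y) = −y, and for all n ≥ 2, U_{τ,n}(y) = (1−y)·U_{τ,n−1}(y) + Σ_{k=2}^{⌊n/2⌋} (−y)^{k−1} C_{k−1} U_{τ,n−2k+1}(y), where C_k = (1/(k+1))·binom(2k,k) is the k-th Catalan number. -/
open scoped Classical

noncomputable section

namespace CWilf

/-- The number of descents of a permutation of `{0, …, n-1}` (0-based). -/
def des {n : ℕ} (σ : Equiv.Perm (Fin n)) : ℕ :=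
  (Finset.univ.filter fun i : Fin n =>
    ∃ h : (i : ℕ) + 1 < n, σ ⟨(i : ℕ) + 1, h⟩ < σ i).card

/-- The number of inversions of `σ`. -/
def inv {n : ℕ} (σ : Equiv.Perm (Fin n)) : ℕ :=
  (Finset.univ.filter fun q : Fin n × Fin n => q.1 < q.2 ∧ σ q.2 < σ q.1).card

/-- The number of coinversions of `σ`. -/
def coinv {n : ℕ} (σ : Equiv.Perm (Fin n)) : ℕ :=
  (Finset.univ.filter fun q : Fin n × Fin n => q.1 < q.2 ∧ σ q.1 < σ q.2).card

/-- The number of left-to-right minima of `σ`. -/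
def LRmin {n : ℕ} (σ : Equiv.Perm (Fin n)) : ℕ :=
  (Finset.univ.filter fun j : Fin n => ∀ i : Fin n, i < j → σ j < σ i).card

/-- There is a `τ`-match of `σ` starting at (0-based) position `i`, i.e.
`red(σ_i σ_{i+1} ⋯ σ_{i+j-1}) = τ`. -/
def MatchAt {j n : ℕ} (τ : Equiv.Perm (Fin j)) (σ : Equiv.Perm (Fin n)) (i : ℕ) : Prop :=
  ∃ h : i + j ≤ n, ∀ a b : Fin j,
    τ a < τ b ↔
      σ ⟨i + (a : ℕ), by have := a.isLt; omega⟩ < σ ⟨i + (b : ℕ), by have := b.isLt; omega⟩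

/-- The number of `τ`-matches of `σ`. -/
def mch {j n : ℕ} (τ : Equiv.Perm (Fin j)) (σ : Equiv.Perm (Fin n)) : ℕ :=
  ((Finset.range n).filter fun i => MatchAt τ σ i).card

/-- `τ` is minimal overlapping: the smallest `n` such that some `σ ∈ S_n` has
exactly two `τ`-matches is `2j - 1`. -/
def MinOverlapping {j : ℕ} (τ : Equiv.Perm (Fin j)) : Prop :=
  IsLeast {n : ℕ | ∃ σ : Equiv.Perm (Fin n), mch τ σ = 2} (2 * j - 1)

/-- `α` and `β` are mutually minimal overlapping. -/
def MutuallyMinOverlapping {j : ℕ} (α β : Equiv.Perm (Fin j)) : Prop :=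
  MinOverlapping α ∧ MinOverlapping β ∧
    IsLeast {n : ℕ | ∃ σ : Equiv.Perm (Fin n), 1 ≤ mch α σ ∧ 1 ≤ mch β σ} (2 * j - 1)

/-- The set of permutations of `S_n` with no `τ`-match. -/
def NM (n : ℕ) {j : ℕ} (τ : Equiv.Perm (Fin j)) : Finset (Equiv.Perm (Fin n)) :=
  Finset.univ.filter fun σ => mch τ σ = 0

/-- `NM_{τ,n}(1,y)`, with `NM_{τ,0}(1,y) = 1` and
`NM_{τ,n}(1,y) = Σ_{σ∈NM_n(τ)} y^{des σ + 1}` for `n ≥ 1` (here `y = Polynomial.X`). -/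
def NMy {p : ℕ} (τ : Equiv.Perm (Fin p)) (n : ℕ) : Polynomial ℚ :=
  if n = 0 then 1 else ∑ σ ∈ NM n τ, Polynomial.X ^ (des σ + 1)

/-- The permutation `1324 ∈ S_4` (0-based one-line notation `0 2 1 3`). -/
def tau1324 : Equiv.Perm (Fin 4) :=
  ⟨![0, 2, 1, 3], ![0, 2, 1, 3], by decide, by decide⟩

/-- The coefficient of `x^m` in `(x C(x))^p`, where `C` is the Catalan generating function. -/
def ballot (p m : ℕ) : ℕ :=
  PowerSeries.coeff m ((PowerSeries.X * PowerSeries.catalanSeries) ^ p)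

theorem ballot_zero_left (m : ℕ) : ballot 0 m = if m = 0 then 1 else 0 := by
  simp [ballot, PowerSeries.coeff_one]

theorem ballot_eq_zero_of_lt {p m : ℕ} (h : m < p) : ballot p m = 0 := by
  rw [ballot, mul_pow, PowerSeries.coeff_X_pow_mul', if_neg (by omega)]

theorem ballot_one_succ (m : ℕ) : ballot 1 (m + 1) = catalan m := by
  rw [ballot, pow_one, mul_comm, PowerSeries.coeff_succ_mul_X, PowerSeries.catalanSeries_coeff]

theorem ballot_succ_succ (p m : ℕ) :
    ballot (p + 1) (m + 1) = ballot p m + ballot (p + 2) (m + 1) := by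
  have key : (PowerSeries.X * PowerSeries.catalanSeries) ^ (p + 1) =
      (PowerSeries.X * PowerSeries.catalanSeries) ^ p * PowerSeries.X +
        (PowerSeries.X * PowerSeries.catalanSeries) ^ (p + 2) := by
    rw [pow_succ]
    nth_rewrite 2 [← PowerSeries.catalanSeries_sq_mul_X_add_one]
    ring
  rw [ballot, key, map_add, PowerSeries.coeff_succ_mul_X, ballot, ballot]

theorem sum_range_ballot {p k m : ℕ} (h : m < p + k) :
    ∑ i ∈ Finset.range k, ballot (p + i) m = ballot (p + 1) (m + 1) := by
  have key : ∀ j, ∑ i ∈ Finset.range j, ballot (p + i) m + ballot (p + j + 1) (m + 1) =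
      ballot (p + 1) (m + 1) := by
    intro j
    induction j with
    | zero => simp
    | succ j ih =>
      rw [← ih, Finset.sum_range_succ, ballot_succ_succ (p + j) m]
      ring_nf
  rw [← key k, ballot_eq_zero_of_lt (p := p + k + 1) (by omega), add_zero]

section Recurrence

variable {R : Type*} [CommRing R]

/-- The cluster polynomials: up to the factor `-y` these are the `U n`, `n ≥ 1`. -/
def clusterPoly (y : R) : ℕ → R
  | 0 => 0
  | 1 => 1
  | n + 2 => -y * clusterPoly y (n + 1) +
      ∑ m : Fin (n / 2 + 1), (-y) ^ (m : ℕ) * (catalan m : R) * clusterPoly y (n + 1 - 2 * m)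
  decreasing_by all_goals omega

theorem clusterPoly_succ_succ (y : R) (n : ℕ) :
    clusterPoly y (n + 2) = -y * clusterPoly y (n + 1) +
      ∑ m ∈ Finset.range (n / 2 + 1),
        (-y) ^ m * (catalan m : R) * clusterPoly y (n + 1 - 2 * m) := by
  rw [clusterPoly, ← Fin.sum_univ_eq_sum_range
    (fun m => (-y) ^ m * (catalan m : R) * clusterPoly y (n + 1 - 2 * m))]

/-- The weighted number of ways to complete a cluster whose last ascent `c < d` is followed by
`p` values between `c` and `d` and `q` values above `d`. -/
def ascentPoly (y : R) (p q : ℕ) : R :=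
  ∑ m ∈ Finset.range ((p + q) / 2 + 1),
    (-y) ^ m * (ballot p m : R) * clusterPoly y (p + q + 1 - 2 * m)

theorem ascentPoly_zero_left (y : R) (q : ℕ) : ascentPoly y 0 q = clusterPoly y (q + 1) := by
  rw [ascentPoly, Finset.sum_range_succ', Finset.sum_eq_zero]
  · simp [ballot_zero_left]
  · intro m _
    simp [ballot_zero_left]

theorem ascentPoly_succ_left (y : R) (p q : ℕ) :
    ascentPoly y (p + 1) q = -y * ∑ i ∈ Finset.range q, ascentPoly y (p + i) (q - 1 - i) := by
  rw [ascentPoly, Finset.sum_range_succ', ballot_eq_zero_of_lt (p := p + 1) (m := 0) (by omega)]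
  have inner : ∀ i ∈ Finset.range q, ascentPoly y (p + i) (q - 1 - i) =
      ∑ m ∈ Finset.range ((p + 1 + q) / 2),
        (-y) ^ m * (ballot (p + i) m : R) * clusterPoly y (p + q - 2 * m) := by
    intro i hi
    have hi := Finset.mem_range.1 hi
    rw [ascentPoly, show (p + i + (q - 1 - i)) / 2 + 1 = (p + 1 + q) / 2 by omega,
      show p + i + (q - 1 - i) + 1 = p + q by omega]
  rw [Finset.sum_congr rfl inner, Finset.sum_comm, Finset.mul_sum]
  simp only [Nat.cast_zero, mul_zero, zero_mul, add_zero]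
  refine Finset.sum_congr rfl fun m hm => ?_
  have hm := Finset.mem_range.1 hm
  rw [← Finset.sum_mul, ← Finset.mul_sum, ← Nat.cast_sum,
    show p + 1 + q + 1 - 2 * (m + 1) = p + q - 2 * m by omega, pow_succ]
  rcases Nat.lt_or_ge m (p + q) with h | h
  · rw [sum_range_ballot h]
    ring
  · have : q = 0 := by omega
    subst this
    rw [ballot_eq_zero_of_lt (p := p + 1) (m := m + 1) (by omega)]
    simp

theorem clusterPoly_eq_sum_ascentPoly (y : R) (n : ℕ) :
    clusterPoly y (n + 2) = -y * clusterPoly y (n + 1) +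
      ∑ p ∈ Finset.range (n + 1), ascentPoly y p (n - p) := by
  rw [clusterPoly_succ_succ]
  congr 1
  have inner : ∀ p ∈ Finset.range (n + 1), ascentPoly y p (n - p) =
      ∑ m ∈ Finset.range (n / 2 + 1),
        (-y) ^ m * (ballot p m : R) * clusterPoly y (n + 1 - 2 * m) := by
    intro p hp
    have hp := Finset.mem_range.1 hp
    rw [ascentPoly, show p + (n - p) = n by omega]
  rw [Finset.sum_congr rfl inner, Finset.sum_comm]
  refine Finset.sum_congr rfl fun m hm => ?_
  have hm := Finset.mem_range.1 hm
  have key := sum_range_ballot (p := 0) (k := n + 1) (m := m) (by omega)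
  simp only [zero_add] at key
  rw [← Finset.sum_mul, ← Finset.mul_sum, ← Nat.cast_sum, key, ballot_one_succ]

end Recurrence

section Rank

variable {α M : Type*} [LinearOrder α] [AddCommMonoid M]

theorem sum_card_filter_lt (A : Finset α) (F : ℕ → M) :
    ∑ b ∈ A, F {z ∈ A | z < b}.card = ∑ i ∈ Finset.range A.card, F i := by
  induction A using Finset.induction_on_max with
  | empty => simp
  | insert a s hs ih =>
    have ha : a ∉ s := fun h => lt_irrefl a (hs a h)
    rw [Finset.sum_insert ha, Finset.card_insert_of_notMem ha, Finset.sum_range_succ, ← ih,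
      add_comm]
    congr 1
    · refine Finset.sum_congr rfl fun b hb => ?_
      rw [Finset.filter_insert, if_neg (hs b hb).not_gt]
    · rw [Finset.filter_insert, if_neg (lt_irrefl a), Finset.filter_true_of_mem hs]

theorem card_filter_lt_add_card_filter_gt {A : Finset α} {b : α} (hb : b ∈ A) :
    {z ∈ A | z < b}.card + {z ∈ A | b < z}.card + 1 = A.card := by
  have h1 := Finset.card_filter_add_card_filter_not (s := A) (fun z => z < b)
  have h2 : {z ∈ A | ¬ z < b} = insert b {z ∈ A | b < z} := by
    ext z
    simp only [Finset.mem_filter, Finset.mem_insert, not_lt, le_iff_lt_or_eq]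
    constructor
    · rintro ⟨h, h' | h'⟩
      · exact Or.inr ⟨h, h'⟩
      · exact Or.inl h'.symm
    · rintro (rfl | ⟨h, h'⟩)
      · exact ⟨hb, Or.inr rfl⟩
      · exact ⟨h, Or.inl h'⟩
  rw [h2, Finset.card_insert_of_notMem (by simp)] at h1
  omega

theorem sum_card_filter_lt_gt (A : Finset α) (F : ℕ → ℕ → M) :
    ∑ b ∈ A, F {z ∈ A | z < b}.card {z ∈ A | b < z}.card =
      ∑ i ∈ Finset.range A.card, F i (A.card - 1 - i) := by
  rw [← sum_card_filter_lt A fun i => F i (A.card - 1 - i)]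
  refine Finset.sum_congr rfl fun b hb => ?_
  have := card_filter_lt_add_card_filter_gt hb
  rw [show A.card - 1 - {z ∈ A | z < b}.card = {z ∈ A | b < z}.card by omega]

theorem sum_sum_powerset_erase (s : Finset α) (f : α → Finset α → M) :
    ∑ b ∈ s, ∑ A ∈ (s.erase b).powerset, f b A =
      ∑ A ∈ s.powerset, ∑ b ∈ A, f b (A.erase b) := by
  rw [Finset.sum_sigma', Finset.sum_sigma']
  refine Finset.sum_bij' (fun p _ => ⟨insert p.1 p.2, p.1⟩) (fun p _ => ⟨p.2, p.1.erase p.2⟩)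
    ?_ ?_ ?_ ?_ ?_
  · rintro ⟨b, A⟩ h
    simp only [Finset.mem_sigma, Finset.mem_powerset] at h ⊢
    refine ⟨Finset.insert_subset h.1 (h.2.trans (Finset.erase_subset _ _)),
      Finset.mem_insert_self _ _⟩
  · rintro ⟨A, b⟩ h
    simp only [Finset.mem_sigma, Finset.mem_powerset] at h ⊢
    exact ⟨h.1 h.2, Finset.erase_subset_erase _ h.1⟩
  · rintro ⟨b, A⟩ h
    simp only [Finset.mem_sigma, Finset.mem_powerset] at h
    have hb : b ∉ A := fun hb => Finset.notMem_erase b s (h.2 hb)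
    simp [Finset.erase_insert hb]
  · rintro ⟨A, b⟩ h
    simp only [Finset.mem_sigma] at h
    simp [Finset.insert_erase h.2]
  · rintro ⟨b, A⟩ h
    simp only [Finset.mem_sigma, Finset.mem_powerset] at h
    have hb : b ∉ A := fun hb => Finset.notMem_erase b s (h.2 hb)
    simp [Finset.erase_insert hb]

theorem sum_ite_isMin {A : Finset α} (hA : A.Nonempty) (f : α → M) :
    (∑ b ∈ A, if ∀ z ∈ A.erase b, b < z then f b else 0) = f (A.min' hA) := by
  rw [Finset.sum_eq_single (A.min' hA)]
  · rw [if_pos]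
    intro z hz
    exact A.min'_lt_of_mem_erase_min' hA hz
  · intro b hb hne
    rw [if_neg]
    intro h
    have h1 := h _ (Finset.mem_erase.2 ⟨hne.symm, A.min'_mem hA⟩)
    exact absurd (A.min'_le b hb) (not_le.2 h1)
  · intro h
    exact absurd (A.min'_mem hA) h

end Rank

section Lists

variable {α : Type*}

/-- The list starts with four entries forming the pattern `1324`. -/
def Starts1324 [LT α] : List α → Prop
  | a :: b :: c :: d :: _ => a < c ∧ c < b ∧ b < d
  | _ => False

/-- The list starts with a descent. -/
def StartsDesc [LT α] : List α → Prop
  | a :: b :: _ => b < a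
  | _ => False

/-- The weight of the first position of a list. -/
def headWeight [LT α] {R : Type*} [CommRing R] (y : R) (l : List α) : R :=
  if Starts1324 l then 0 else if StartsDesc l then y else 1

/-- `y ^ des` if the list has no consecutive `1324`, and `0` otherwise. -/
def listWeight [LT α] {R : Type*} [CommRing R] (y : R) : List α → R
  | [] => 1
  | a :: l => headWeight y (a :: l) * listWeight y l

/-- The orderings of a finite set. -/
def orderings (s : Finset α) : Finset (List α) :=
  ⟨Multiset.lists s.val, Multiset.lists_nodup_finset s⟩

theorem mem_orderings {s : Finset α} {l : List α} : l ∈ orderings s ↔ s.val = (l : Multiset α) :=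
  Multiset.mem_lists_iff _ _

theorem orderings_empty : orderings (∅ : Finset α) = {[]} := by
  ext l
  rw [mem_orderings, Finset.mem_singleton, Finset.empty_val, eq_comm, Multiset.coe_eq_zero]

theorem sum_orderings [DecidableEq α] {M : Type*} [AddCommMonoid M] {s : Finset α}
    (hs : s.Nonempty) (f : List α → M) :
    ∑ l ∈ orderings s, f l = ∑ a ∈ s, ∑ l ∈ orderings (s.erase a), f (a :: l) := by
  rw [Finset.sum_sigma']
  symm
  refine Finset.sum_bij (fun p _ => p.1 :: p.2) ?_ ?_ ?_ ?_
  · rintro ⟨a, l⟩ h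
    simp only [Finset.mem_sigma, mem_orderings, Finset.erase_val] at h ⊢
    rw [← Multiset.cons_coe, ← h.2, Multiset.cons_erase h.1]
  · rintro ⟨a, l⟩ _ ⟨b, m⟩ _ h
    simp only [List.cons.injEq] at h
    rw [h.1, h.2]
  · intro l hl
    rw [mem_orderings] at hl
    cases l with
    | nil =>
      rw [Multiset.coe_nil, Finset.val_eq_zero] at hl
      exact absurd hl hs.ne_empty
    | cons a l =>
      have ha : a ∈ s := by
        rw [← Finset.mem_val, hl]
        simp
      refine ⟨⟨a, l⟩, ?_, rfl⟩
      simp only [Finset.mem_sigma, mem_orderings, Finset.erase_val]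
      refine ⟨ha, ?_⟩
      rw [hl, ← Multiset.cons_coe, Multiset.erase_cons_head]
  · intros
    rfl

variable [LinearOrder α] {R : Type*} [CommRing R] (y : R)

/-- `NM(1,y)` for the orderings of `s`. -/
def avoiders (s : Finset α) : R :=
  if s = ∅ then 1 else y * ∑ l ∈ orderings s, listWeight y l

/-- Total weight of the lists `a :: l` with `l` an ordering of `s`. -/
def afterOne (a : α) (s : Finset α) : R :=
  ∑ l ∈ orderings s, listWeight y (a :: l)

/-- Total weight of the lists `a :: b :: l` with `l` an ordering of `s`. -/
def afterTwo (a b : α) (s : Finset α) : R :=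
  ∑ l ∈ orderings s, listWeight y (a :: b :: l)

theorem avoiders_eq {s : Finset α} (hs : s.Nonempty) :
    avoiders y s = y * ∑ a ∈ s, afterOne y a (s.erase a) := by
  rw [avoiders, if_neg hs.ne_empty, sum_orderings hs]
  rfl

theorem afterOne_empty (a : α) : afterOne y a ∅ = 1 := by
  simp [afterOne, orderings_empty, listWeight, headWeight, Starts1324, StartsDesc]

theorem afterOne_eq {s : Finset α} (hs : s.Nonempty) (a : α) :
    afterOne y a s = ∑ b ∈ s, afterTwo y a b (s.erase b) := by
  rw [afterOne, sum_orderings hs]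
  rfl

theorem afterTwo_of_gt {a b : α} (h : b < a) (s : Finset α) :
    afterTwo y a b s = y * afterOne y b s := by
  rw [afterTwo, afterOne, Finset.mul_sum]
  refine Finset.sum_congr rfl fun l _ => ?_
  rw [listWeight]
  congr 1
  have h1 : ¬ Starts1324 (a :: b :: l) := by
    rcases l with _ | ⟨c, _ | ⟨d, l⟩⟩ <;> simp only [Starts1324, not_false_eq_true]
    rintro ⟨h1, h2, -⟩
    exact absurd h (h1.trans h2).not_gt
  rw [headWeight, if_neg h1, if_pos]
  exact h

theorem listWeight_cons_of_lt {a b : α} (h : a < b) (l : List α) :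
    listWeight y (a :: b :: l) = listWeight y (b :: l) -
      if Starts1324 (a :: b :: l) then listWeight y (b :: l) else 0 := by
  rw [listWeight, headWeight]
  have h2 : ¬ StartsDesc (a :: b :: l) := h.not_gt
  by_cases h1 : Starts1324 (a :: b :: l) <;> simp [h1, h2]

theorem listWeight_cons_of_gt {b c d : α} {l : List α} (hcb : c < b) :
    listWeight y (b :: c :: d :: l) = y * listWeight y (c :: d :: l) := by
  rw [listWeight]
  congr 1
  have h1 : ¬ Starts1324 (b :: c :: d :: l) := by
    rcases l with _ | ⟨e, l⟩ <;> simp only [Starts1324, not_false_eq_true]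
    rintro ⟨h1, h2, -⟩
    exact absurd hcb (h1.trans h2).not_gt
  rw [headWeight, if_neg h1, if_pos]
  exact hcb

theorem afterTwo_of_lt {a b : α} (h : a < b) (s : Finset α) :
    afterTwo y a b s = afterOne y b s - y * ∑ c ∈ s, ∑ d ∈ s.erase c,
      if a < c ∧ c < b ∧ b < d then afterTwo y c d ((s.erase c).erase d) else 0 := by
  simp only [afterTwo, listWeight_cons_of_lt y h, Finset.sum_sub_distrib]
  congr 1
  rcases s.eq_empty_or_nonempty with rfl | hs
  · simp [orderings_empty, Starts1324]
  rw [sum_orderings hs, Finset.mul_sum]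
  refine Finset.sum_congr rfl fun c _ => ?_
  rcases (s.erase c).eq_empty_or_nonempty with he | he
  · simp [he, orderings_empty, Starts1324]
  rw [sum_orderings he, Finset.mul_sum]
  refine Finset.sum_congr rfl fun d _ => ?_
  by_cases hm : a < c ∧ c < b ∧ b < d
  · rw [if_pos hm, Finset.mul_sum]
    refine Finset.sum_congr rfl fun l _ => ?_
    rw [if_pos (show Starts1324 (a :: b :: c :: d :: l) from hm), listWeight_cons_of_gt y hm.2.1]
  · rw [if_neg hm, mul_zero]
    refine Finset.sum_eq_zero fun l _ => ?_
    rw [if_neg (show ¬ Starts1324 (a :: b :: c :: d :: l) from hm)]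

end Lists

section Clusters

variable {α : Type*} [LinearOrder α] {R : Type*} [CommRing R] (y : R)

theorem erase_sdiff_erase {s A : Finset α} {b : α} (hb : b ∈ A) :
    s.erase b \ A.erase b = s \ A := by
  ext z
  simp only [Finset.mem_sdiff, Finset.mem_erase]
  constructor
  · rintro ⟨⟨h1, h2⟩, h3⟩
    exact ⟨h2, fun h => h3 ⟨h1, h⟩⟩
  · rintro ⟨h1, h2⟩
    exact ⟨⟨fun h => h2 (h ▸ hb), h1⟩, fun h => h2 h.2⟩

theorem clusterPoly_card_succ {A : Finset α} (hA : A.Nonempty) :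
    clusterPoly y (A.card + 1) = -y * clusterPoly y A.card +
      ∑ b ∈ A, ascentPoly y {z ∈ A | z < b}.card {z ∈ A | b < z}.card := by
  obtain ⟨n, hn⟩ : ∃ n, A.card = n + 1 := ⟨A.card - 1, by have := hA.card_pos; omega⟩
  rw [sum_card_filter_lt_gt A (ascentPoly y), hn, clusterPoly_eq_sum_ascentPoly]
  rfl

theorem filter_erase_lt {A : Finset α} (b : α) : {z ∈ A.erase b | z < b} = {z ∈ A | z < b} := by
  ext z
  simp only [Finset.mem_filter, Finset.mem_erase]
  exact ⟨fun h => ⟨h.1.2, h.2⟩, fun h => ⟨⟨h.2.ne, h.1⟩, h.2⟩⟩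

theorem filter_erase_gt {A : Finset α} (b : α) : {z ∈ A.erase b | b < z} = {z ∈ A | b < z} := by
  ext z
  simp only [Finset.mem_filter, Finset.mem_erase]
  exact ⟨fun h => ⟨h.1.2, h.2⟩, fun h => ⟨⟨h.2.ne', h.1⟩, h.2⟩⟩

/-- Splitting off the least element `c < b` and an element `d > b` from `A`. -/
theorem ascentPoly_card {A : Finset α} {b : α} (hb : b ∉ A) (hA : A.Nonempty)
    (hlt : A.min' hA < b) :
    ascentPoly y {z ∈ A | z < b}.card {z ∈ A | b < z}.card =
      -y * ∑ d ∈ A.erase (A.min' hA), if b < d then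
        ascentPoly y {z ∈ (A.erase (A.min' hA)).erase d | z < d}.card
          {z ∈ (A.erase (A.min' hA)).erase d | d < z}.card else 0 := by
  set c := A.min' hA with hc
  have hcA : c ∈ A := A.min'_mem hA
  have hcp : c ∈ {z ∈ A | z < b} := Finset.mem_filter.2 ⟨hcA, hlt⟩
  obtain ⟨p, hp⟩ : ∃ p, {z ∈ A | z < b}.card = p + 1 :=
    ⟨_, (Nat.succ_pred_eq_of_pos (Finset.card_pos.2 ⟨c, hcp⟩)).symm⟩
  rw [hp, ascentPoly_succ_left, ← Finset.sum_filter]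
  have hset : {d ∈ A.erase c | b < d} = {d ∈ A | b < d} := by
    ext z
    simp only [Finset.mem_filter, Finset.mem_erase]
    exact ⟨fun h => ⟨h.1.2, h.2⟩, fun h => ⟨⟨(hlt.trans h.2).ne', h.1⟩, h.2⟩⟩
  rw [hset, ← sum_card_filter_lt_gt {d ∈ A | b < d} fun i j => ascentPoly y (p + i) j]
  congr 1
  refine Finset.sum_congr rfl fun d hd => ?_
  have hd := Finset.mem_filter.1 hd
  rw [filter_erase_lt, filter_erase_gt]
  congr 1
  · have h1 : {z ∈ A.erase c | z < d} =
        ({z ∈ A | z < b}.erase c) ∪ {z ∈ {z ∈ A | b < z} | z < d} := by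
      ext z
      simp only [Finset.mem_filter, Finset.mem_erase, Finset.mem_union]
      constructor
      · rintro ⟨⟨h1, h2⟩, h3⟩
        rcases lt_trichotomy z b with h | h | h
        · exact Or.inl ⟨h1, h2, h⟩
        · exact absurd (h ▸ h2) hb
        · exact Or.inr ⟨⟨h2, h⟩, h3⟩
      · rintro (⟨h1, h2, h3⟩ | ⟨⟨h1, h2⟩, h3⟩)
        · exact ⟨⟨h1, h2⟩, h3.trans hd.2⟩
        · exact ⟨⟨(hlt.trans h2).ne', h1⟩, h3⟩
    rw [h1, Finset.card_union_of_disjoint, Finset.card_erase_of_mem hcp, hp]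
    · simp
    · rw [Finset.disjoint_left]
      intro z hz hz'
      simp only [Finset.mem_filter, Finset.mem_erase] at hz hz'
      exact absurd hz.2.2 hz'.1.2.not_gt
  · congr 1
    ext z
    simp only [Finset.mem_filter, Finset.mem_erase]
    constructor
    · rintro ⟨⟨h1, h2⟩, h3⟩
      exact ⟨⟨(hlt.trans (hd.2.trans h3)).ne', h1⟩, h3⟩
    · rintro ⟨⟨h1, h2⟩, h3⟩
      exact ⟨⟨h2, hd.2.trans h3⟩, h3⟩

theorem afterOne_step {s : Finset α} (hs : s.Nonempty) {a : α} (ha : a ∉ s)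
    (h1 : ∀ b ∈ s, afterOne y b (s.erase b) = ∑ A ∈ (s.erase b).powerset,
      if ∀ z ∈ A, b < z then clusterPoly y (A.card + 1) * avoiders y (s.erase b \ A) else 0)
    (h2 : ∀ b ∈ s, a < b → afterTwo y a b (s.erase b) = ∑ A ∈ (s.erase b).powerset,
      if ∀ z ∈ A, a < z then ascentPoly y {z ∈ A | z < b}.card {z ∈ A | b < z}.card *
        avoiders y (s.erase b \ A) else 0) :
    afterOne y a s = ∑ A ∈ s.powerset,
      if ∀ z ∈ A, a < z then clusterPoly y (A.card + 1) * avoiders y (s \ A) else 0 := by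
  have e1 : afterOne y a s = avoiders y s + ∑ b ∈ s, ∑ A ∈ (s.erase b).powerset,
      (-y * (if a < b ∧ ∀ z ∈ A, b < z then
          clusterPoly y (A.card + 1) * avoiders y (s.erase b \ A) else 0) +
        if a < b ∧ ∀ z ∈ A, a < z then
          ascentPoly y {z ∈ A | z < b}.card {z ∈ A | b < z}.card *
            avoiders y (s.erase b \ A) else 0) := by
    rw [afterOne_eq y hs, avoiders_eq y hs, Finset.mul_sum, ← Finset.sum_add_distrib]
    refine Finset.sum_congr rfl fun b hb => ?_
    rw [Finset.sum_add_distrib, ← Finset.mul_sum]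
    rcases lt_or_gt_of_ne (show a ≠ b from fun h => ha (h ▸ hb)) with h | h
    · simp only [h, true_and]
      rw [← h1 b hb, ← h2 b hb h]
      ring
    · simp only [h.not_gt, false_and, if_false, Finset.sum_const_zero]
      rw [afterTwo_of_gt y h]
      ring
  have e2 : avoiders y s = ∑ A ∈ s.powerset, if A = ∅ then avoiders y s else 0 := by
    rw [Finset.sum_ite_eq' s.powerset ∅, if_pos (Finset.empty_mem_powerset s)]
  rw [e1, e2, sum_sum_powerset_erase, ← Finset.sum_add_distrib]
  refine Finset.sum_congr rfl fun A _ => ?_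
  rcases A.eq_empty_or_nonempty with rfl | hA
  · simp [clusterPoly]
  rw [if_neg hA.ne_empty, zero_add]
  by_cases hall : ∀ z ∈ A, a < z
  · rw [if_pos hall, clusterPoly_card_succ y hA, Finset.sum_add_distrib, ← Finset.mul_sum,
      add_mul, Finset.sum_mul]
    congr 1
    · have := sum_ite_isMin hA fun _ => clusterPoly y A.card * avoiders y (s \ A)
      rw [mul_assoc, ← this]
      congr 1
      refine Finset.sum_congr rfl fun b hb => ?_
      rw [erase_sdiff_erase hb, Finset.card_erase_add_one hb]
      simp only [hall b hb, true_and]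
    · refine Finset.sum_congr rfl fun b hb => ?_
      rw [erase_sdiff_erase hb, if_pos ⟨hall b hb, fun z hz => hall z (Finset.mem_of_mem_erase hz)⟩,
        filter_erase_lt, filter_erase_gt]
  · rw [if_neg hall]
    refine Finset.sum_eq_zero fun b hb => ?_
    have key : a < b → ¬ ∀ z ∈ A.erase b, a < z := fun hab h => hall fun z hz => by
      by_cases hzb : z = b
      · exact hzb ▸ hab
      · exact h z (Finset.mem_erase.2 ⟨hzb, hz⟩)
    rw [if_neg, if_neg, mul_zero, add_zero]
    · exact fun h => key h.1 h.2
    · exact fun h => key h.1 fun z hz => h.1.trans (h.2 z hz)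

theorem afterTwo_step {s : Finset α} {a b : α} (hab : a < b) (hb : b ∉ s)
    (h1 : afterOne y b s = ∑ A ∈ s.powerset,
      if ∀ z ∈ A, b < z then clusterPoly y (A.card + 1) * avoiders y (s \ A) else 0)
    (h2 : ∀ c ∈ s, ∀ d ∈ s.erase c, c < d → afterTwo y c d ((s.erase c).erase d) =
      ∑ A ∈ ((s.erase c).erase d).powerset,
        if ∀ z ∈ A, c < z then ascentPoly y {z ∈ A | z < d}.card {z ∈ A | d < z}.card *
          avoiders y ((s.erase c).erase d \ A) else 0) :
    afterTwo y a b s = ∑ A ∈ s.powerset,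
      if ∀ z ∈ A, a < z then ascentPoly y {z ∈ A | z < b}.card {z ∈ A | b < z}.card *
        avoiders y (s \ A) else 0 := by
  have e1 : (∑ c ∈ s, ∑ d ∈ s.erase c,
        if a < c ∧ c < b ∧ b < d then afterTwo y c d ((s.erase c).erase d) else 0) =
      ∑ A ∈ s.powerset, ∑ c ∈ A, ∑ d ∈ A.erase c,
        if (a < c ∧ c < b ∧ b < d) ∧ ∀ z ∈ (A.erase c).erase d, c < z then
          ascentPoly y {z ∈ (A.erase c).erase d | z < d}.card
            {z ∈ (A.erase c).erase d | d < z}.card *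
              avoiders y ((s.erase c).erase d \ (A.erase c).erase d) else 0 := by
    rw [← sum_sum_powerset_erase s fun c A => ∑ d ∈ A,
        if (a < c ∧ c < b ∧ b < d) ∧ ∀ z ∈ A.erase d, c < z then
          ascentPoly y {z ∈ A.erase d | z < d}.card {z ∈ A.erase d | d < z}.card *
              avoiders y ((s.erase c).erase d \ A.erase d) else 0]
    refine Finset.sum_congr rfl fun c hc => ?_
    rw [← sum_sum_powerset_erase (s.erase c) fun d A =>
        if (a < c ∧ c < b ∧ b < d) ∧ ∀ z ∈ A, c < z then
          ascentPoly y {z ∈ A | z < d}.card {z ∈ A | d < z}.card *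
              avoiders y ((s.erase c).erase d \ A) else 0]
    refine Finset.sum_congr rfl fun d hd => ?_
    by_cases h : a < c ∧ c < b ∧ b < d
    · simp only [h, true_and, and_self, if_true]
      exact h2 c hc d hd (h.2.1.trans h.2.2)
    · simp only [h, false_and, if_false, Finset.sum_const_zero]
  rw [afterTwo_of_lt y hab, h1, e1, Finset.mul_sum, ← Finset.sum_sub_distrib]
  refine Finset.sum_congr rfl fun A hA => ?_
  have hbA : b ∉ A := fun h => hb (Finset.mem_powerset.1 hA h)
  have e2 : ∀ c ∈ A, ∀ d ∈ A.erase c,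
      (if (a < c ∧ c < b ∧ b < d) ∧ ∀ z ∈ (A.erase c).erase d, c < z then
          ascentPoly y {z ∈ (A.erase c).erase d | z < d}.card
            {z ∈ (A.erase c).erase d | d < z}.card *
              avoiders y ((s.erase c).erase d \ (A.erase c).erase d) else 0) =
      if ∀ z ∈ A.erase c, c < z then if a < c ∧ c < b then if b < d then
          ascentPoly y {z ∈ (A.erase c).erase d | z < d}.card
            {z ∈ (A.erase c).erase d | d < z}.card * avoiders y (s \ A) else 0 else 0 else 0 := by
    intro c hc d hd
    rw [erase_sdiff_erase hd, erase_sdiff_erase hc]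
    simp only [← ite_and]
    refine if_congr ?_ rfl rfl
    constructor
    · rintro ⟨⟨h1, h2, h3⟩, h4⟩
      refine ⟨fun z hz => ?_, ⟨h1, h2⟩, h3⟩
      by_cases hzd : z = d
      · exact hzd ▸ h2.trans h3
      · exact h4 z (Finset.mem_erase.2 ⟨hzd, hz⟩)
    · rintro ⟨h1, ⟨h2, h3⟩, h4⟩
      exact ⟨⟨h2, h3, h4⟩, fun z hz => h1 z (Finset.mem_of_mem_erase hz)⟩
  rw [Finset.sum_congr rfl fun c hc => Finset.sum_congr rfl (e2 c hc)]
  simp only [Finset.sum_ite_irrel, Finset.sum_const_zero]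
  rcases A.eq_empty_or_nonempty with rfl | hne
  · simp [ascentPoly_zero_left]
  rw [sum_ite_isMin hne]
  have hmin : ∀ t, t < A.min' hne ↔ ∀ z ∈ A, t < z := fun t => Finset.lt_min'_iff A hne
  simp only [← hmin]
  rcases lt_or_gt_of_ne (show A.min' hne ≠ b from fun h => hbA (h ▸ A.min'_mem hne)) with h | h
  · rw [if_neg h.not_gt, ascentPoly_card y hbA hne h]
    simp only [h, and_true]
    split_ifs with h3
    · simp only [mul_assoc, Finset.sum_mul, ite_mul, zero_mul, zero_sub, neg_mul]
    · simp
  · have h3 : {z ∈ A | z < b} = ∅ :=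
      Finset.filter_eq_empty_iff.2 fun z hz => ((hmin b).1 h z hz).not_gt
    have h4 : {z ∈ A | b < z} = A := Finset.filter_true_of_mem ((hmin b).1 h)
    rw [if_pos h, if_pos (hab.trans h), if_neg fun h5 => h5.2.not_gt h, h3, h4,
      Finset.card_empty, ascentPoly_zero_left]
    simp

theorem afterOne_and_afterTwo_eq (n : ℕ) : ∀ s : Finset α, s.card = n →
    (∀ a ∉ s, afterOne y a s = ∑ A ∈ s.powerset,
      if ∀ z ∈ A, a < z then clusterPoly y (A.card + 1) * avoiders y (s \ A) else 0) ∧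
    (∀ a b, a < b → b ∉ s → afterTwo y a b s = ∑ A ∈ s.powerset,
      if ∀ z ∈ A, a < z then ascentPoly y {z ∈ A | z < b}.card {z ∈ A | b < z}.card *
        avoiders y (s \ A) else 0) := by
  induction n using Nat.strong_induction_on with
  | _ n ih =>
    intro s hn
    have hone : ∀ a ∉ s, afterOne y a s = ∑ A ∈ s.powerset,
        if ∀ z ∈ A, a < z then clusterPoly y (A.card + 1) * avoiders y (s \ A) else 0 := by
      intro a ha
      rcases s.eq_empty_or_nonempty with rfl | hs
      · simp [afterOne_empty, clusterPoly, avoiders]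
      · refine afterOne_step y hs ha (fun b hb => ?_) fun b hb hab => ?_
        · exact (ih _ (hn ▸ Finset.card_erase_lt_of_mem hb) _ rfl).1 b (Finset.notMem_erase b s)
        · exact (ih _ (hn ▸ Finset.card_erase_lt_of_mem hb) _ rfl).2 a b hab
            (Finset.notMem_erase b s)
    refine ⟨hone, fun a b hab hb => afterTwo_step y hab hb (hone b hb) fun c hc d hd hcd => ?_⟩
    exact (ih _ (hn ▸ (Finset.card_erase_lt_of_mem hd).trans (Finset.card_erase_lt_of_mem hc))
      _ rfl).2 c d hcd (Finset.notMem_erase d _)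

theorem avoiders_eq_sum_powerset {s : Finset α} (hs : s.Nonempty) :
    avoiders y s = y * ∑ A ∈ s.powerset, clusterPoly y A.card * avoiders y (s \ A) := by
  have e1 : ∀ a ∈ s, afterOne y a (s.erase a) = ∑ A ∈ (s.erase a).powerset,
      if ∀ z ∈ A, a < z then clusterPoly y (A.card + 1) * avoiders y (s.erase a \ A) else 0 :=
    fun a _ => (afterOne_and_afterTwo_eq y _ _ rfl).1 a (Finset.notMem_erase a s)
  rw [avoiders_eq y hs, Finset.sum_congr rfl e1, sum_sum_powerset_erase]
  congr 1
  refine Finset.sum_congr rfl fun A _ => ?_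
  rcases A.eq_empty_or_nonempty with rfl | hA
  · simp [clusterPoly]
  rw [← sum_ite_isMin hA fun _ => clusterPoly y A.card * avoiders y (s \ A)]
  refine Finset.sum_congr rfl fun b hb => ?_
  rw [erase_sdiff_erase hb, Finset.card_erase_add_one hb]

end Clusters

section Permutations

variable {R : Type*} [CommRing R] (y : R)

theorem starts1324_iff {α : Type*} [LT α] (l : List α) :
    Starts1324 l ↔ ∃ h : 4 ≤ l.length, l[0] < l[2] ∧ l[2] < l[1] ∧ l[1] < l[3] := by
  rcases l with _ | ⟨a, _ | ⟨b, _ | ⟨c, _ | ⟨d, l⟩⟩⟩⟩ <;> simp [Starts1324]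

theorem startsDesc_iff {α : Type*} [LT α] (l : List α) :
    StartsDesc l ↔ ∃ h : 2 ≤ l.length, l[1] < l[0] := by
  rcases l with _ | ⟨a, _ | ⟨b, l⟩⟩ <;> simp [StartsDesc]

theorem listWeight_eq_prod {α : Type*} [LT α] (l : List α) :
    listWeight y l = ∏ i ∈ Finset.range l.length, headWeight y (l.drop i) := by
  induction l with
  | nil => simp [listWeight]
  | cons a l ih =>
    rw [listWeight, ih, List.length_cons, Finset.prod_range_succ', mul_comm]
    rfl

theorem listWeight_map {α β : Type*} [LinearOrder α] [LinearOrder β] (f : α ↪o β) (l : List α) :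
    listWeight y (l.map f) = listWeight y l := by
  induction l with
  | nil => rfl
  | cons a l ih =>
    rw [List.map_cons, listWeight, listWeight, ih, ← List.map_cons]
    congr 1
    simp [headWeight, starts1324_iff, startsDesc_iff]

theorem card_orderings {α : Type*} (s : Finset α) :
    (orderings s).card = s.card.factorial := by
  change Multiset.card (Multiset.lists s.val) = _
  rw [← Finset.coe_toList s, Multiset.lists_coe, Multiset.coe_card, List.length_permutations,
    Finset.length_toList]

theorem avoiders_map {α β : Type*} [LinearOrder α] [LinearOrder β] (f : α ↪o β) (s : Finset α) :
    avoiders y (s.map f.toEmbedding) = avoiders y s := by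
  have horder : orderings (s.map f.toEmbedding) =
      (orderings s).map ⟨List.map f, List.map_injective_iff.2 f.injective⟩ := by
    symm
    apply Finset.eq_of_subset_of_card_le
    · intro l hl
      obtain ⟨m, hm, rfl⟩ := Finset.mem_map.1 hl
      rw [mem_orderings] at hm ⊢
      rw [Finset.map_val, hm]
      rfl
    · rw [Finset.card_map, card_orderings, card_orderings, Finset.card_map]
  rw [avoiders, avoiders, horder, Finset.sum_map]
  simp only [Finset.map_eq_empty, Function.Embedding.coeFn_mk, listWeight_map]

theorem sum_orderings_univ {M : Type*} [AddCommMonoid M] {n : ℕ} (F : List (Fin n) → M) :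
    ∑ l ∈ orderings (Finset.univ : Finset (Fin n)), F l =
      ∑ σ : Equiv.Perm (Fin n), F (List.ofFn σ) := by
  symm
  refine Finset.sum_bij (fun σ _ => List.ofFn σ) ?_ ?_ ?_ fun _ _ => rfl
  · intro σ _
    rw [mem_orderings]
    refine (Multiset.Nodup.ext Finset.univ.nodup
      (Multiset.coe_nodup.2 (List.nodup_ofFn.2 σ.injective))).2 fun a => ?_
    simp only [Finset.mem_val, Finset.mem_univ, Multiset.mem_coe, List.mem_ofFn, true_iff]
    exact σ.surjective a
  · intro σ _ τ _ h
    exact Equiv.coe_fn_injective (List.ofFn_injective h)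
  · intro l hl
    rw [mem_orderings] at hl
    have hlen : l.length = n := by
      rw [← Multiset.coe_card, ← hl]
      simp
    have hnd : l.Nodup := by
      rw [← Multiset.coe_nodup, ← hl]
      exact Finset.univ.nodup
    refine ⟨Equiv.ofBijective (fun i : Fin n => l.get (i.cast hlen.symm))
      (Finite.injective_iff_bijective.1 (hnd.injective_get.comp (Fin.cast_injective _))),
      Finset.mem_univ _, List.ext_getElem (by simp [hlen]) fun i h1 h2 => ?_⟩
    simp

theorem starts1324_drop_ofFn {n : ℕ} (σ : Equiv.Perm (Fin n)) (i : ℕ) :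
    Starts1324 ((List.ofFn σ).drop i) ↔ MatchAt tau1324 σ i := by
  rw [starts1324_iff]
  simp only [List.length_drop, List.length_ofFn, List.getElem_drop, List.getElem_ofFn]
  constructor
  · rintro ⟨h, h1, h2, h3⟩
    refine ⟨by omega, fun a b => ?_⟩
    simp only [add_zero] at h1
    fin_cases a <;> fin_cases b <;> simp [tau1324] <;> order
  · rintro ⟨h, hm⟩
    exact ⟨by omega, (hm 0 2).1 (by decide), (hm 2 1).1 (by decide), (hm 1 3).1 (by decide)⟩

theorem startsDesc_drop_ofFn {n : ℕ} (σ : Equiv.Perm (Fin n)) (i : Fin n) :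
    StartsDesc ((List.ofFn σ).drop i) ↔ ∃ h : (i : ℕ) + 1 < n, σ ⟨(i : ℕ) + 1, h⟩ < σ i := by
  rw [startsDesc_iff]
  simp only [List.length_drop, List.length_ofFn, List.getElem_drop, List.getElem_ofFn]
  exact ⟨fun ⟨h, h'⟩ => ⟨by omega, h'⟩, fun ⟨h, h'⟩ => ⟨by omega, h'⟩⟩

theorem listWeight_ofFn {n : ℕ} (σ : Equiv.Perm (Fin n)) :
    listWeight y (List.ofFn σ) = if mch tau1324 σ = 0 then y ^ des σ else 0 := by
  rw [listWeight_eq_prod, List.length_ofFn]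
  have hmch : mch tau1324 σ = 0 ↔ ∀ i ∈ Finset.range n, ¬ MatchAt tau1324 σ i := by
    rw [mch, Finset.card_eq_zero, Finset.filter_eq_empty_iff]
  split_ifs with h
  · rw [hmch] at h
    rw [← Fin.prod_univ_eq_prod_range (fun i => headWeight y ((List.ofFn σ).drop i)), des,
      ← Finset.prod_const, Finset.prod_filter]
    refine Finset.prod_congr rfl fun i _ => ?_
    rw [headWeight, if_neg (by rw [starts1324_drop_ofFn]; exact h i (Finset.mem_range.2 i.2))]
    exact if_congr (startsDesc_drop_ofFn σ i) rfl rfl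
  · rw [hmch] at h
    push Not at h
    obtain ⟨i, hi, hm⟩ := h
    refine Finset.prod_eq_zero hi ?_
    rw [headWeight, if_pos ((starts1324_drop_ofFn σ i).2 hm)]

theorem avoiders_univ (n : ℕ) :
    avoiders Polynomial.X (Finset.univ : Finset (Fin n)) = NMy tau1324 n := by
  rw [avoiders, NMy, sum_orderings_univ]
  rcases Nat.eq_zero_or_pos n with rfl | hn
  · simp
  · have : NeZero n := ⟨hn.ne'⟩
    rw [if_neg Finset.univ_nonempty.ne_empty, if_neg hn.ne', NM, Finset.sum_filter, Finset.mul_sum]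
    refine Finset.sum_congr rfl fun σ _ => ?_
    rw [listWeight_ofFn, mul_ite, mul_zero, pow_succ']

theorem avoiders_eq_NMy {α : Type*} [LinearOrder α] (s : Finset α) :
    avoiders Polynomial.X s = NMy tau1324 s.card := by
  rw [← avoiders_univ, ← avoiders_map _ (s.orderEmbOfFin rfl), Finset.map_orderEmbOfFin_univ]

theorem NMy_eq_sum {n : ℕ} (hn : 1 ≤ n) :
    NMy tau1324 n = Polynomial.X * ∑ k ∈ Finset.range (n + 1),
      (n.choose k : Polynomial ℚ) * clusterPoly Polynomial.X k * NMy tau1324 (n - k) := by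
  have : NeZero n := ⟨by omega⟩
  rw [← avoiders_univ, avoiders_eq_sum_powerset _ Finset.univ_nonempty]
  have key := Finset.sum_powerset_apply_card (x := (Finset.univ : Finset (Fin n)))
    fun k => clusterPoly (Polynomial.X : Polynomial ℚ) k * NMy tau1324 (n - k)
  simp only [Finset.card_univ, Fintype.card_fin, nsmul_eq_mul, ← mul_assoc] at key
  rw [← key]
  refine congrArg _ (Finset.sum_congr rfl fun A hA => ?_)
  rw [avoiders_eq_NMy, Finset.card_sdiff_of_subset (Finset.mem_powerset.1 hA), Finset.card_univ,
    Fintype.card_fin]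

end Permutations

theorem eq_neg_X_mul_clusterPoly (U : ℕ → Polynomial ℚ) (hU0 : U 0 = 1)
    (hUdef : ∀ n : ℕ, 1 ≤ n →
      ∑ k ∈ Finset.range (n + 1),
        (Nat.choose n k : Polynomial ℚ) * U k * NMy tau1324 (n - k) = 0) {n : ℕ} (hn : 1 ≤ n) :
    U n = -Polynomial.X * clusterPoly Polynomial.X n := by
  induction n using Nat.strong_induction_on with
  | _ n ih =>
    obtain ⟨m, rfl⟩ : ∃ m, n = m + 1 := ⟨n - 1, by omega⟩
    have h1 := hUdef (m + 1) hn
    have h2 := NMy_eq_sum hn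
    have h3 : NMy tau1324 0 = 1 := by simp [NMy]
    rw [Finset.sum_range_succ, Finset.sum_range_succ'] at h1 h2
    have h4 : ∑ k ∈ Finset.range m,
        ((m + 1).choose (k + 1) : Polynomial ℚ) * U (k + 1) * NMy tau1324 (m + 1 - (k + 1)) =
        -Polynomial.X * ∑ k ∈ Finset.range m, ((m + 1).choose (k + 1) : Polynomial ℚ) *
          clusterPoly Polynomial.X (k + 1) * NMy tau1324 (m + 1 - (k + 1)) := by
      rw [Finset.mul_sum]
      refine Finset.sum_congr rfl fun k hk => ?_
      have hk := Finset.mem_range.1 hk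
      rw [ih (k + 1) (by omega) (by omega)]
      ring
    rw [h4] at h1
    simp only [Nat.choose_zero_right, Nat.choose_self, Nat.cast_one, hU0, Nat.sub_self, h3,
      Nat.sub_zero, one_mul, mul_one, clusterPoly, zero_mul, add_zero] at h1 h2
    linear_combination h1 - h2

/-- Theorem (Jones–Remmel): if `U : ℕ → ℚ[y]` satisfies `U 0 = 1` and
`Σ_{k=0}^n C(n,k) U_k NM_{1324,n-k}(1,y) = 0` for `n ≥ 1`, then `U 1 = -y` and,
for all `n ≥ 2`,
`U n = (1-y) U (n-1) + Σ_{k=2}^{⌊n/2⌋} (-y)^{k-1} C_{k-1} U (n-2k+1)`,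
where `C_k` is the `k`-th Catalan number. -/
theorem stmt16 (U : ℕ → Polynomial ℚ) (hU0 : U 0 = 1)
    (hUdef : ∀ n : ℕ, 1 ≤ n →
      ∑ k ∈ Finset.range (n + 1),
        (Nat.choose n k : Polynomial ℚ) * U k * NMy tau1324 (n - k) = 0) :
    U 1 = -Polynomial.X ∧
    ∀ n : ℕ, 2 ≤ n →
      U n = (1 - Polynomial.X) * U (n - 1) +
        ∑ k ∈ Finset.Icc 2 (n / 2),
          (-Polynomial.X) ^ (k - 1) * (catalan (k - 1) : Polynomial ℚ) *
            U (n - 2 * k + 1) := by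
  have hU : ∀ m, U (m + 1) = -Polynomial.X * clusterPoly Polynomial.X (m + 1) := fun m =>
    eq_neg_X_mul_clusterPoly U hU0 hUdef (by omega)
  refine ⟨by simp [hU 0, clusterPoly], fun n hn => ?_⟩
  obtain ⟨m, rfl⟩ : ∃ m, n = m + 2 := ⟨n - 2, by omega⟩
  rw [hU (m + 1), show m + 2 - 1 = m + 1 from rfl, hU m, clusterPoly_succ_succ,
    Finset.sum_range_succ', show (m + 2) / 2 = m / 2 + 1 by omega,
    ← Finset.Ico_add_one_right_eq_Icc, Finset.sum_Ico_eq_sum_range,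
    show m / 2 + 1 + 1 - 2 = m / 2 by omega]
  have hsum : ∀ k ∈ Finset.range (m / 2),
      (-Polynomial.X) ^ (2 + k - 1) * (catalan (2 + k - 1) : Polynomial ℚ) *
        U (m + 2 - 2 * (2 + k) + 1) =
      -Polynomial.X * ((-Polynomial.X) ^ (k + 1) * (catalan (k + 1) : Polynomial ℚ) *
        clusterPoly Polynomial.X (m + 1 - 2 * (k + 1))) := by
    intro k hk
    have hk := Finset.mem_range.1 hk
    rw [hU, show 2 + k - 1 = k + 1 by omega,
      show m + 2 - 2 * (2 + k) + 1 = m + 1 - 2 * (k + 1) by omega]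
    ring
  rw [Finset.sum_congr rfl hsum, ← Finset.mul_sum, catalan_zero]
  simp only [Nat.cast_one, pow_zero, mul_zero, Nat.sub_zero]
  ring

end CWilf
end
end

section
/- For n ≥ 1 and a subset T ⊆ {1,…,n}, let σ^T ∈ S_{3n+2} be the permutation σ^T = 1 b_1 b_2 ⋯ b_n 2, where b_k is the block (3k+1)(3k+2)(3k) if k ∉ T and the block (3k+2)(3k)(3k+1) if k ∈ T. Then the 2^n permutations {σ^T : T ⊆ {1,…,n}} are pairwise distinct and pairwise (des,inv)-c-Wilf equivalent: for any T, T' ⊆ {1,…,n} and all m ≥ 0, Σ_{σ∈NM_m(σ^T)} x^{des(σ)} q^{inv(σ)} = Σ_{σ∈NM_m(σ^{T'})} x^{des(σ)} q^{inv(σ)} as polynomials in x and q. In particular, the (des,inv)-c-Wilf equivalence class of σ^∅ has size at least 2^n. -/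
open scoped Classical

noncomputable section

namespace CWilf

/-- `SigmaTSpec n T π` says that `π ∈ S_{3n+2}` is the permutation
`σ^T = 1 b₁ b₂ ⋯ b_n 2` of the paper (1-based one-line notation), where
`b_k = (3k+1)(3k+2)(3k)` if `k ∉ T` and `b_k = (3k+2)(3k)(3k+1)` if `k ∈ T`.
Everything is written 0-based: position `3k-2, 3k-1, 3k` carry the values of
block `b_k`, shifted down by one. -/
def SigmaTSpec (n : ℕ) (T : Finset ℕ) (π : Equiv.Perm (Fin (3 * n + 2))) : Prop :=
  π ⟨0, by omega⟩ = ⟨0, by omega⟩ ∧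
  π ⟨3 * n + 1, by omega⟩ = ⟨1, by omega⟩ ∧
  ∀ k : ℕ, ∀ hk1 : 1 ≤ k, ∀ hk2 : k ≤ n,
    (k ∉ T →
      π ⟨3 * k - 2, by omega⟩ = ⟨3 * k, by omega⟩ ∧
      π ⟨3 * k - 1, by omega⟩ = ⟨3 * k + 1, by omega⟩ ∧
      π ⟨3 * k, by omega⟩ = ⟨3 * k - 1, by omega⟩) ∧
    (k ∈ T →
      π ⟨3 * k - 2, by omega⟩ = ⟨3 * k + 1, by omega⟩ ∧
      π ⟨3 * k - 1, by omega⟩ = ⟨3 * k - 1, by omega⟩ ∧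
      π ⟨3 * k, by omega⟩ = ⟨3 * k, by omega⟩)

/-- The value that `σ^T` takes at position `p` (0-based). -/
def sigmaVal (n : ℕ) (T : Finset ℕ) (p : ℕ) : ℕ :=
  if p = 0 then 0 else if p = 3 * n + 1 then 1 else
    if (p + 2) / 3 ∈ T then
      (if p % 3 = 1 then p + 3 else p)
    else (if p % 3 = 0 then p - 1 else p + 2)

theorem sigmaVal_lt (n : ℕ) (T : Finset ℕ) {p : ℕ} (hp : p < 3 * n + 2) :
    sigmaVal n T p < 3 * n + 2 := by
  unfold sigmaVal
  split_ifs <;> omega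

theorem sigmaVal_block (n : ℕ) (T : Finset ℕ) {p : ℕ} (_ : p ≠ 0) (_ : p < 3 * n + 1) :
    (sigmaVal n T p + 1) / 3 = (p + 2) / 3 := by
  unfold sigmaVal
  split_ifs <;> omega

theorem sigmaVal_injOn (n : ℕ) (T : Finset ℕ) {p q : ℕ} (hp : p < 3 * n + 2)
    (hq : q < 3 * n + 2) (h : sigmaVal n T p = sigmaVal n T q) : p = q := by
  have key : (p + 2) / 3 = (q + 2) / 3 → p = q := by
    intro hk
    unfold sigmaVal at h
    rw [hk] at h
    split_ifs at h <;> omega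
  by_cases hp0 : p = 0 ∨ p = 3 * n + 1 ∨ q = 0 ∨ q = 3 * n + 1
  · unfold sigmaVal at h
    split_ifs at h <;> omega
  · have h1 := sigmaVal_block n T (p := p) (by omega) (by omega)
    have h2 := sigmaVal_block n T (p := q) (by omega) (by omega)
    rw [h] at h1
    exact key (h1.symm.trans h2)

theorem exists_sigmaTSpec (n : ℕ) (T : Finset ℕ) :
    ∃ π : Equiv.Perm (Fin (3 * n + 2)), SigmaTSpec n T π := by
  let f : Fin (3 * n + 2) → Fin (3 * n + 2) := fun p => ⟨sigmaVal n T p, sigmaVal_lt n T p.2⟩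
  have hf : Function.Injective f := fun p q h =>
    Fin.ext (sigmaVal_injOn n T p.2 q.2 (Fin.mk.inj h))
  refine ⟨Equiv.ofBijective f (Finite.injective_iff_bijective.mp hf), ?_, ?_, ?_⟩
  · simp [f, sigmaVal]
  · simp [f, sigmaVal]
  · intro k hk1 hk2
    have e1 : (3 * k - 2 + 2) / 3 = k := by omega
    have e2 : (3 * k - 1 + 2) / 3 = k := by omega
    have e3 : (3 * k + 2) / 3 = k := by omega
    constructor <;> intro hk <;> refine ⟨?_, ?_, ?_⟩ <;>
      · simp only [f, Equiv.ofBijective_apply, Fin.mk.injEq, sigmaVal, e1, e2, e3, hk, if_true,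
          if_false]
        split_ifs <;> omega

theorem SigmaTSpec.val_eq {n : ℕ} {T : Finset ℕ} {π : Equiv.Perm (Fin (3 * n + 2))}
    (h : SigmaTSpec n T π) (p : Fin (3 * n + 2)) : (π p : ℕ) = sigmaVal n T p := by
  obtain ⟨h0, h1, h2⟩ := h
  obtain ⟨p, hp⟩ := p
  by_cases hp0 : p = 0
  · subst hp0
    rw [h0]
    simp [sigmaVal]
  by_cases hp1 : p = 3 * n + 1
  · subst hp1
    simp [h1, sigmaVal]
  obtain ⟨k, hk⟩ : ∃ k, k = (p + 2) / 3 := ⟨_, rfl⟩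
  obtain ⟨ha, hb⟩ := h2 k (by omega) (by omega)
  have hr : p = 3 * k - 2 ∨ p = 3 * k - 1 ∨ p = 3 * k := by omega
  by_cases hkT : k ∈ T
  · obtain ⟨x, y, z⟩ := hb hkT
    simp only [sigmaVal, hp0, hp1, ← hk, hkT, if_true, if_false]
    rcases hr with hr | hr | hr <;> subst hr <;> simp only [x, y, z] <;> split_ifs <;> omega
  · obtain ⟨x, y, z⟩ := ha hkT
    simp only [sigmaVal, hp0, hp1, ← hk, hkT, if_false]
    rcases hr with hr | hr | hr <;> subst hr <;> simp only [x, y, z] <;> split_ifs <;> omega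

theorem SigmaTSpec.index_eq {n : ℕ} {T T' : Finset ℕ} (hT : T ⊆ Finset.Icc 1 n)
    (hT' : T' ⊆ Finset.Icc 1 n) {π : Equiv.Perm (Fin (3 * n + 2))}
    (h : SigmaTSpec n T π) (h' : SigmaTSpec n T' π) : T = T' := by
  have key : ∀ k, 1 ≤ k → k ≤ n → (k ∈ T ↔ k ∈ T') := by
    intro k hk1 hk2
    have e := (h.val_eq ⟨3 * k, by omega⟩).symm.trans (h'.val_eq ⟨3 * k, by omega⟩)
    have e3 : (3 * k + 2) / 3 = k := by omega
    simp only [sigmaVal, e3] at e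
    by_cases a : k ∈ T <;> by_cases b : k ∈ T' <;> simp only [a, b, if_true, if_false] at e ⊢ <;>
      split_ifs at e <;> omega
  ext k
  constructor
  · intro hk
    have := Finset.mem_Icc.mp (hT hk)
    exact (key k this.1 this.2).mp hk
  · intro hk
    have := Finset.mem_Icc.mp (hT' hk)
    exact (key k this.1 this.2).mpr hk

theorem sigmaVal_descent_iff (n : ℕ) (T : Finset ℕ) {p : ℕ} (hp : p + 1 < 3 * n + 2) :
    sigmaVal n T (p + 1) < sigmaVal n T p ↔
      p ≠ 0 ∧ (p = 3 * n ∨ if (p + 2) / 3 ∈ T then p % 3 = 1 else p % 3 = 2) := by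
  by_cases hr : p % 3 = 0
  · by_cases hn : p = 3 * n
    · unfold sigmaVal
      split_ifs <;> omega
    · unfold sigmaVal
      split_ifs <;> first | omega | contradiction
  · have e : (p + 1 + 2) / 3 = (p + 2) / 3 := by omega
    unfold sigmaVal
    rw [e]
    split_ifs <;> first | omega | contradiction

theorem SigmaTSpec.des_eq {n : ℕ} (hn : 1 ≤ n) {T : Finset ℕ}
    {π : Equiv.Perm (Fin (3 * n + 2))} (h : SigmaTSpec n T π) : des π = n + 1 := by
  have hmem : ∀ i : Fin (3 * n + 2), (∃ h : (i : ℕ) + 1 < 3 * n + 2, π ⟨(i : ℕ) + 1, h⟩ < π i) ↔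
      (i : ℕ) + 1 < 3 * n + 2 ∧ (i : ℕ) ≠ 0 ∧ ((i : ℕ) = 3 * n ∨
        if ((i : ℕ) + 2) / 3 ∈ T then (i : ℕ) % 3 = 1 else (i : ℕ) % 3 = 2) := by
    intro i
    constructor
    · rintro ⟨hi, hlt⟩
      rw [Fin.lt_def, h.val_eq, h.val_eq, sigmaVal_descent_iff n T hi] at hlt
      exact ⟨hi, hlt⟩
    · rintro ⟨hi, hlt⟩
      refine ⟨hi, ?_⟩
      rw [Fin.lt_def, h.val_eq, h.val_eq, sigmaVal_descent_iff n T hi]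
      exact hlt
  unfold des
  rw [← Finset.card_range (n + 1)]
  refine Finset.card_bij (fun i _ => if (i : ℕ) = 3 * n then 0 else ((i : ℕ) + 2) / 3) ?_ ?_ ?_
  · intro i hi
    simp only [Finset.mem_filter, Finset.mem_univ, true_and, hmem] at hi
    rw [Finset.mem_range]
    split_ifs <;> omega
  · intro i hi j hj e
    simp only [Finset.mem_filter, Finset.mem_univ, true_and, hmem] at hi hj
    apply Fin.ext
    by_cases hi3 : (i : ℕ) = 3 * n
    · simp only [hi3, if_true] at e
      split_ifs at e <;> omega
    by_cases hj3 : (j : ℕ) = 3 * n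
    · simp only [hj3, if_true, hi3, if_false] at e
      omega
    simp only [hi3, hj3, if_false] at e
    obtain ⟨hi1, hi2, hi | hi⟩ := hi
    · omega
    obtain ⟨hj1, hj2, hj | hj⟩ := hj
    · omega
    rw [e] at hi
    split_ifs at hi hj <;> omega
  · intro k hk
    rw [Finset.mem_range] at hk
    by_cases hk0 : k = 0
    · refine ⟨⟨3 * n, by omega⟩, ?_, ?_⟩
      · simp only [Finset.mem_filter, Finset.mem_univ, true_and, hmem]
        exact ⟨by omega, by omega, Or.inl trivial⟩
      · simp [hk0]
    by_cases hkT : k ∈ T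
    · have e1 : (3 * k - 2 + 2) / 3 = k := by omega
      refine ⟨⟨3 * k - 2, by omega⟩, ?_, ?_⟩
      · simp only [Finset.mem_filter, Finset.mem_univ, true_and, hmem, e1, hkT, if_true]
        omega
      · simp only [e1]
        split_ifs <;> omega
    · have e1 : (3 * k - 1 + 2) / 3 = k := by omega
      refine ⟨⟨3 * k - 1, by omega⟩, ?_, ?_⟩
      · simp only [Finset.mem_filter, Finset.mem_univ, true_and, hmem, e1, hkT, if_false]
        omega
      · simp only [e1]
        split_ifs <;> omega

theorem sigmaVal_inversion_iff (n : ℕ) (T : Finset ℕ) {p q : ℕ} (hpq : p < q)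
    (hq : q < 3 * n + 2) :
    sigmaVal n T q < sigmaVal n T p ↔
      p ≠ 0 ∧ (q = 3 * n + 1 ∨ (p + 2) / 3 = (q + 2) / 3 ∧
        if (p + 2) / 3 ∈ T then p % 3 = 1 else q % 3 = 0) := by
  by_cases hp0 : p = 0
  · unfold sigmaVal
    split_ifs <;> omega
  by_cases hq1 : q = 3 * n + 1
  · unfold sigmaVal
    split_ifs <;> omega
  by_cases hk : (p + 2) / 3 = (q + 2) / 3
  · unfold sigmaVal
    rw [hk]
    split_ifs <;> omega
  · have h1 := sigmaVal_block n T (p := p) (by omega) (by omega)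
    have h2 := sigmaVal_block n T (p := q) (by omega) (by omega)
    simp only [hp0, hq1, hk, ne_eq, not_false_eq_true, false_and, or_false, and_false, iff_false]
    omega

theorem SigmaTSpec.inv_eq {n : ℕ} {T : Finset ℕ}
    {π : Equiv.Perm (Fin (3 * n + 2))} (h : SigmaTSpec n T π) :
    inv π = ((Finset.range (6 * n + 1)).filter
      fun x => 1 ≤ x ∧ (3 * n < x → x % 3 ≠ 0)).card := by
  have hmem : ∀ u : Fin (3 * n + 2) × Fin (3 * n + 2), (u.1 < u.2 ∧ π u.2 < π u.1) ↔
      (u.1 : ℕ) < u.2 ∧ (u.1 : ℕ) ≠ 0 ∧ ((u.2 : ℕ) = 3 * n + 1 ∨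
        ((u.1 : ℕ) + 2) / 3 = ((u.2 : ℕ) + 2) / 3 ∧
        if ((u.1 : ℕ) + 2) / 3 ∈ T then (u.1 : ℕ) % 3 = 1 else (u.2 : ℕ) % 3 = 0) := by
    intro u
    refine and_congr_right fun hlt => ?_
    rw [Fin.lt_def, h.val_eq, h.val_eq]
    exact sigmaVal_inversion_iff n T hlt u.2.2
  unfold inv
  refine Finset.card_bij (fun u _ => if (u.2 : ℕ) = 3 * n + 1 then (u.1 : ℕ) else
    if ((u.1 : ℕ) + 2) / 3 ∈ T then 3 * n + u.2 - 1 else 3 * n + u.1) ?_ ?_ ?_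
  · rintro ⟨⟨p, hp⟩, ⟨q, hq⟩⟩ hu
    simp only [Finset.mem_filter, Finset.mem_univ, true_and, hmem] at hu
    simp only [Finset.mem_filter, Finset.mem_range]
    obtain ⟨hu1, hu2, hu3⟩ := hu
    by_cases hpT : (p + 2) / 3 ∈ T <;> simp only [hpT, if_true, if_false] at hu3 ⊢ <;>
      split_ifs <;> omega
  · rintro ⟨⟨p, hp⟩, ⟨q, hq⟩⟩ hu ⟨⟨p', hp'⟩, ⟨q', hq'⟩⟩ hu' e
    simp only [Finset.mem_filter, Finset.mem_univ, true_and, hmem] at hu hu'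
    simp only at e
    obtain ⟨hu1, hu2, hu3⟩ := hu
    obtain ⟨hu1', hu2', hu3'⟩ := hu'
    simp only [Prod.mk.injEq, Fin.mk.injEq]
    by_cases hk : (p + 2) / 3 = (p' + 2) / 3
    · rw [hk] at hu3 e
      by_cases hpT : (p' + 2) / 3 ∈ T <;> simp only [hpT, if_true, if_false] at hu3 hu3' e <;>
        split_ifs at e <;> omega
    · by_cases hpT : (p + 2) / 3 ∈ T <;> by_cases hpT' : (p' + 2) / 3 ∈ T <;>
        simp only [hpT, hpT', if_true, if_false] at hu3 hu3' e <;>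
        split_ifs at e <;> omega
  · intro x hx
    simp only [Finset.mem_filter, Finset.mem_range] at hx
    by_cases hx1 : x ≤ 3 * n
    · refine ⟨(⟨x, by omega⟩, ⟨3 * n + 1, by omega⟩), ?_, ?_⟩
      · simp only [Finset.mem_filter, Finset.mem_univ, true_and, hmem]
        exact ⟨by omega, by omega, Or.inl trivial⟩
      · simp
    obtain ⟨y, rfl⟩ : ∃ y, x = 3 * n + y := ⟨x - 3 * n, by omega⟩
    obtain ⟨k, hk⟩ : ∃ k, k = (y + 2) / 3 := ⟨_, rfl⟩
    by_cases hkT : k ∈ T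
    · have e1 : (3 * k - 2 + 2) / 3 = k := by omega
      refine ⟨(⟨3 * k - 2, by omega⟩, ⟨y + 1, by omega⟩), ?_, ?_⟩
      · simp only [Finset.mem_filter, Finset.mem_univ, true_and, hmem, e1, hkT, if_true]
        omega
      · simp only [e1, hkT, if_true]
        split_ifs <;> omega
    · refine ⟨(⟨y, by omega⟩, ⟨3 * k, by omega⟩), ?_, ?_⟩
      · simp only [Finset.mem_filter, Finset.mem_univ, true_and, hmem, ← hk, hkT, if_false]
        omega
      · simp only [← hk, hkT, if_false]
        split_ifs <;> omega

/-- `τ` starts with its smallest value and ends with its second smallest value. -/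
def MinAtEnds {j : ℕ} (τ : Equiv.Perm (Fin j)) : Prop :=
  ∀ a b : Fin j, ((a : ℕ) = 0 → (b : ℕ) ≠ 0 → τ a < τ b) ∧
    ((a : ℕ) + 1 = j → (b : ℕ) ≠ 0 → (b : ℕ) + 1 ≠ j → τ a < τ b)

theorem SigmaTSpec.minAtEnds {n : ℕ} {T : Finset ℕ} {π : Equiv.Perm (Fin (3 * n + 2))}
    (h : SigmaTSpec n T π) : MinAtEnds π := by
  intro a b
  simp only [Fin.lt_def, h.val_eq]
  have ha := a.2
  have hb := b.2
  constructor
  · intro h1 h2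
    unfold sigmaVal
    split_ifs <;> omega
  · intro h1 h2 h3
    unfold sigmaVal
    split_ifs <;> omega

/-- Matches of two patterns of the type `MinAtEnds` share at most one position. -/
theorem MatchAt.not_overlap {j m : ℕ} {α β : Equiv.Perm (Fin j)} (hα : MinAtEnds α)
    (hβ : MinAtEnds β) {σ : Equiv.Perm (Fin m)} {k l : ℕ} (hk : MatchAt α σ k)
    (hl : MatchAt β σ l) (h1 : k < l) (h2 : l + 1 < k + j) : False := by
  obtain ⟨hk0, hk⟩ := hk
  obtain ⟨hl0, hl⟩ := hl
  have e1 := (hk ⟨j - 1, by omega⟩ ⟨l - k, by omega⟩).mp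
    ((hα _ _).2 (by simp only; omega) (by simp only; omega) (by simp only; omega))
  have e2 := (hl ⟨0, by omega⟩ ⟨k + j - 1 - l, by omega⟩).mp
    ((hβ _ _).1 rfl (by simp only; omega))
  rw [Fin.lt_def] at e1 e2
  have c1 : k + (l - k) = l + 0 := by omega
  have c2 : l + (k + j - 1 - l) = k + (j - 1) := by omega
  simp only [c1, c2] at e1 e2
  omega

/-- The window of length `j` starting at position `k`. -/
def window {j m k : ℕ} (h : k + j ≤ m) : Fin j ↪ Fin m where
  toFun a := ⟨k + a, by have := a.isLt; omega⟩
  inj' a b hab := by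
    have := Fin.mk.inj hab
    exact Fin.ext (by omega)

theorem window_val {j m k : ℕ} (h : k + j ≤ m) (a : Fin j) : (window h a : ℕ) = k + a := rfl

/-- The permutation of positions acting as `ρ` on the window starting at `k`. -/
def windowPerm {j m k : ℕ} (h : k + j ≤ m) (ρ : Equiv.Perm (Fin j)) : Equiv.Perm (Fin m) :=
  ρ.viaFintypeEmbedding (window h)

theorem windowPerm_apply_window {j m k : ℕ} (h : k + j ≤ m) (ρ : Equiv.Perm (Fin j))
    (a : Fin j) : windowPerm h ρ (window h a) = window h (ρ a) :=
  Equiv.Perm.viaFintypeEmbedding_apply_image _ _ _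

theorem exists_window_eq {j m k : ℕ} (h : k + j ≤ m) {p : Fin m} (h1 : k ≤ (p : ℕ))
    (h2 : (p : ℕ) < k + j) : ∃ a : Fin j, (a : ℕ) = p - k ∧ window h a = p :=
  ⟨⟨p - k, by omega⟩, rfl, Fin.ext (by rw [window_val]; simp only; omega)⟩

theorem windowPerm_apply_of_notMem {j m k : ℕ} (h : k + j ≤ m) (ρ : Equiv.Perm (Fin j))
    {p : Fin m} (hp : ¬ (k ≤ (p : ℕ) ∧ (p : ℕ) < k + j)) : windowPerm h ρ p = p := by
  refine Equiv.Perm.viaFintypeEmbedding_apply_notMem_range _ _ ?_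
  rintro ⟨a, rfl⟩
  apply hp
  have := a.isLt
  simp only [window_val]
  omega

theorem windowPerm_mem_iff {j m k : ℕ} (h : k + j ≤ m) (ρ : Equiv.Perm (Fin j)) (p : Fin m) :
    (k ≤ (windowPerm h ρ p : ℕ) ∧ (windowPerm h ρ p : ℕ) < k + j) ↔
      (k ≤ (p : ℕ) ∧ (p : ℕ) < k + j) := by
  by_cases hp : k ≤ (p : ℕ) ∧ (p : ℕ) < k + j
  · obtain ⟨a, -, rfl⟩ := exists_window_eq h hp.1 hp.2
    rw [windowPerm_apply_window]
    have := (ρ a).isLt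
    simp only [window_val]
    omega
  · rw [windowPerm_apply_of_notMem h ρ hp]

theorem windowPerm_mul_cancel {j m k : ℕ} (h : k + j ≤ m) {ρ ρ' : Equiv.Perm (Fin j)}
    (hρ : ρ * ρ' = 1) : windowPerm h ρ * windowPerm h ρ' = 1 := by
  ext p
  rw [Equiv.Perm.mul_apply, Equiv.Perm.one_apply]
  by_cases hp : k ≤ (p : ℕ) ∧ (p : ℕ) < k + j
  · obtain ⟨a, -, rfl⟩ := exists_window_eq h hp.1 hp.2
    rw [windowPerm_apply_window, windowPerm_apply_window, ← Equiv.Perm.mul_apply, hρ,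
      Equiv.Perm.one_apply]
  · rw [windowPerm_apply_of_notMem h ρ' hp, windowPerm_apply_of_notMem h ρ hp]

theorem matchAt_iff_window {j m k : ℕ} (h : k + j ≤ m) (τ : Equiv.Perm (Fin j))
    (σ : Equiv.Perm (Fin m)) :
    MatchAt τ σ k ↔ ∀ a b : Fin j, τ a < τ b ↔ σ (window h a) < σ (window h b) :=
  ⟨fun ⟨_, H⟩ => H, fun H => ⟨h, H⟩⟩

/-- Rearranging an `α`-match into a `β`-match. -/
theorem MatchAt.mul_windowPerm {j m k : ℕ} (h : k + j ≤ m) {α : Equiv.Perm (Fin j)}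
    (β : Equiv.Perm (Fin j)) {σ : Equiv.Perm (Fin m)} (hk : MatchAt α σ k) :
    MatchAt β (σ * windowPerm h (α⁻¹ * β)) k := by
  rw [matchAt_iff_window h] at hk ⊢
  intro a b
  rw [Equiv.Perm.mul_apply, Equiv.Perm.mul_apply, windowPerm_apply_window,
    windowPerm_apply_window, ← hk]
  simp

theorem MinAtEnds.inv_mul_apply_end {j : ℕ} {α β : Equiv.Perm (Fin j)} (hα : MinAtEnds α)
    (hβ : MinAtEnds β) {a : Fin j} (ha : (a : ℕ) = 0 ∨ (a : ℕ) + 1 = j) :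
    (α⁻¹ * β) a = a := by
  have hval : ∀ τ : Equiv.Perm (Fin j), MinAtEnds τ → ∀ a : Fin j, (a : ℕ) = 0 →
      (τ a : ℕ) = 0 := by
    intro τ hτ a ha
    have hj := a.isLt
    by_contra hne
    obtain ⟨b, hb⟩ := τ.surjective ⟨0, by omega⟩
    have hb0 : (b : ℕ) ≠ 0 := by
      intro h0
      have : b = a := Fin.ext (by omega)
      rw [← this, hb] at hne
      exact hne rfl
    have := (hτ a b).1 ha hb0
    rw [hb, Fin.lt_def] at this
    simp at this
  have hval' : ∀ τ : Equiv.Perm (Fin j), MinAtEnds τ → ∀ a : Fin j, (a : ℕ) ≠ 0 →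
      (a : ℕ) + 1 = j → (τ a : ℕ) = 1 := by
    intro τ hτ a ha ha'
    have h0 := (hτ ⟨0, by omega⟩ a).1 rfl ha
    rw [Fin.lt_def, hval τ hτ _ rfl] at h0
    by_contra hne
    obtain ⟨b, hb⟩ := τ.surjective ⟨1, by omega⟩
    have hb0 : (b : ℕ) ≠ 0 := by
      intro h0
      have := hval τ hτ b h0
      rw [hb] at this
      simp at this
    have hb1 : (b : ℕ) + 1 ≠ j := by
      intro h1
      have : b = a := Fin.ext (by omega)
      rw [← this, hb] at hne
      exact hne rfl
    have := (hτ a b).2 ha' hb0 hb1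
    rw [hb, Fin.lt_def] at this
    simp only at this
    omega
  rw [Equiv.Perm.mul_apply, Equiv.Perm.inv_eq_iff_eq]
  apply Fin.ext
  by_cases h0 : (a : ℕ) = 0
  · rw [hval α hα a h0, hval β hβ a h0]
  · rw [hval' α hα a h0 (by omega), hval' β hβ a h0 (by omega)]

theorem windowPerm_apply_of_notMem_interior {j m k : ℕ} (h : k + j ≤ m)
    {α β : Equiv.Perm (Fin j)} (hα : MinAtEnds α) (hβ : MinAtEnds β) {p : Fin m}
    (hp : (p : ℕ) ≤ k ∨ k + j ≤ (p : ℕ) + 1) : windowPerm h (α⁻¹ * β) p = p := by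
  by_cases hw : k ≤ (p : ℕ) ∧ (p : ℕ) < k + j
  · obtain ⟨a, ha, hap⟩ := exists_window_eq h hw.1 hw.2
    have hj := a.isLt
    rw [← hap, windowPerm_apply_window, hα.inv_mul_apply_end hβ (by omega)]
  · exact windowPerm_apply_of_notMem h _ hw

theorem MatchAt.mul_windowPerm_of_ne {j m k l : ℕ} (h : k + j ≤ m) {α β τ : Equiv.Perm (Fin j)}
    (hα : MinAtEnds α) (hβ : MinAtEnds β) (hτ : MinAtEnds τ) {σ : Equiv.Perm (Fin m)}
    (hk : MatchAt α σ k) (hl : MatchAt τ σ l) (hkl : l ≠ k) :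
    MatchAt τ (σ * windowPerm h (α⁻¹ * β)) l := by
  have hfar : l + j ≤ k + 1 ∨ k + j ≤ l + 1 := by
    rcases Nat.lt_or_gt_of_ne hkl with hlt | hlt
    · left
      by_contra hc
      exact hl.not_overlap hτ hα hk hlt (by omega)
    · right
      by_contra hc
      exact hk.not_overlap hα hτ hl hlt (by omega)
  obtain ⟨hl0, hl⟩ := hl
  refine ⟨hl0, fun a b => ?_⟩
  have ha := a.isLt
  have hb := b.isLt
  rw [Equiv.Perm.mul_apply, Equiv.Perm.mul_apply,
    windowPerm_apply_of_notMem_interior h hα hβ (by simp only; omega),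
    windowPerm_apply_of_notMem_interior h hα hβ (by simp only; omega)]
  exact hl a b

theorem card_filter_and_add_card_filter_and_not {ι : Type*} (s : Finset ι) (p q : ι → Prop)
    [DecidablePred p] [DecidablePred fun a => p a ∧ q a] [DecidablePred fun a => p a ∧ ¬ q a] :
    (s.filter fun a => p a ∧ q a).card + (s.filter fun a => p a ∧ ¬ q a).card =
      (s.filter p).card := by
  rw [← Finset.card_filter_add_card_filter_not (s := s.filter p) q]
  congr 1 <;> congr 1 <;> ext a <;> simp [and_assoc]

theorem MatchAt.des_eq {j m k : ℕ} {τ : Equiv.Perm (Fin j)} {σ : Equiv.Perm (Fin m)}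
    (hk : MatchAt τ σ k) :
    des σ = des τ + (Finset.univ.filter fun i : Fin m =>
      (∃ h : (i : ℕ) + 1 < m, σ ⟨(i : ℕ) + 1, h⟩ < σ i) ∧
        ¬ (k ≤ (i : ℕ) ∧ (i : ℕ) + 1 < k + j)).card := by
  have h := hk.1
  rw [matchAt_iff_window h] at hk
  have hw : ∀ (a : Fin j) (ha : (a : ℕ) + 1 < j) (h' : (window h a : ℕ) + 1 < m),
      (⟨(window h a : ℕ) + 1, h'⟩ : Fin m) = window h ⟨a + 1, ha⟩ := fun _ _ _ => rfl
  have hin : des τ = (Finset.univ.filter fun i : Fin m =>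
      (∃ h : (i : ℕ) + 1 < m, σ ⟨(i : ℕ) + 1, h⟩ < σ i) ∧
        (k ≤ (i : ℕ) ∧ (i : ℕ) + 1 < k + j)).card := by
    unfold des
    refine Finset.card_bij (fun a _ => window h a) ?_ (fun _ _ _ _ e => (window h).injective e) ?_
    · intro a ha
      simp only [Finset.mem_filter, Finset.mem_univ, true_and] at ha ⊢
      obtain ⟨ha1, ha2⟩ := ha
      have hv : (window h a : ℕ) = k + a := rfl
      refine ⟨⟨by omega, ?_⟩, by omega, by omega⟩
      rw [hw a ha1, ← hk]
      exact ha2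
    · intro p hp
      simp only [Finset.mem_filter, Finset.mem_univ, true_and] at hp
      obtain ⟨⟨hp1, hp2⟩, hp3, hp4⟩ := hp
      obtain ⟨a, ha, rfl⟩ := exists_window_eq h hp3 (by omega)
      have ha1 : (a : ℕ) + 1 < j := by omega
      refine ⟨a, ?_, rfl⟩
      simp only [Finset.mem_filter, Finset.mem_univ, true_and]
      rw [hw a ha1, ← hk] at hp2
      exact ⟨ha1, hp2⟩
  rw [hin]
  exact (card_filter_and_add_card_filter_and_not _ _ _).symm

theorem MatchAt.inv_eq {j m k : ℕ} {τ : Equiv.Perm (Fin j)} {σ : Equiv.Perm (Fin m)}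
    (hk : MatchAt τ σ k) :
    inv σ = inv τ + (Finset.univ.filter fun u : Fin m × Fin m =>
      (u.1 < u.2 ∧ σ u.2 < σ u.1) ∧ ¬ ((k ≤ (u.1 : ℕ) ∧ (u.1 : ℕ) < k + j) ∧
        (k ≤ (u.2 : ℕ) ∧ (u.2 : ℕ) < k + j))).card := by
  have h := hk.1
  rw [matchAt_iff_window h] at hk
  have hlt : ∀ a b : Fin j, window h a < window h b ↔ a < b := by
    intro a b
    simp only [Fin.lt_def, window_val]
    omega
  have hin : inv τ = (Finset.univ.filter fun u : Fin m × Fin m =>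
      (u.1 < u.2 ∧ σ u.2 < σ u.1) ∧ ((k ≤ (u.1 : ℕ) ∧ (u.1 : ℕ) < k + j) ∧
        (k ≤ (u.2 : ℕ) ∧ (u.2 : ℕ) < k + j))).card := by
    unfold inv
    refine Finset.card_bij (fun u _ => (window h u.1, window h u.2)) ?_ ?_ ?_
    · rintro ⟨a, b⟩ hu
      simp only [Finset.mem_filter, Finset.mem_univ, true_and] at hu ⊢
      rw [hlt, ← hk]
      have ha := a.isLt
      have hb := b.isLt
      refine ⟨hu, ?_⟩
      simp only [window_val]
      omega
    · rintro ⟨a, b⟩ _ ⟨a', b'⟩ _ e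
      rw [Prod.mk.injEq] at e ⊢
      exact ⟨(window h).injective e.1, (window h).injective e.2⟩
    · rintro ⟨p, q⟩ hu
      simp only [Finset.mem_filter, Finset.mem_univ, true_and] at hu
      obtain ⟨hu, hp, hq⟩ := hu
      obtain ⟨a, -, rfl⟩ := exists_window_eq h hp.1 hp.2
      obtain ⟨b, -, rfl⟩ := exists_window_eq h hq.1 hq.2
      refine ⟨(a, b), ?_, rfl⟩
      simp only [Finset.mem_filter, Finset.mem_univ, true_and]
      rw [hlt, ← hk] at hu
      exact hu
  rw [hin]
  exact (card_filter_and_add_card_filter_and_not _ _ _).symm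

theorem MatchAt.des_mul_windowPerm {j m k : ℕ} (h : k + j ≤ m) {α β : Equiv.Perm (Fin j)}
    (hα : MinAtEnds α) (hβ : MinAtEnds β) (hdes : des α = des β) {σ : Equiv.Perm (Fin m)}
    (hk : MatchAt α σ k) : des (σ * windowPerm h (α⁻¹ * β)) = des σ := by
  rw [(hk.mul_windowPerm h β).des_eq, hk.des_eq, hdes]
  congr 2
  refine Finset.filter_congr fun i _ => and_congr_left fun hi => exists_congr fun hi' => ?_
  rw [Equiv.Perm.mul_apply, Equiv.Perm.mul_apply,
    windowPerm_apply_of_notMem_interior h hα hβ (by simp only; omega),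
    windowPerm_apply_of_notMem_interior h hα hβ (by omega)]

theorem MatchAt.inv_mul_windowPerm {j m k : ℕ} (h : k + j ≤ m) {α β : Equiv.Perm (Fin j)}
    (hinv : inv α = inv β) {σ : Equiv.Perm (Fin m)}
    (hk : MatchAt α σ k) : inv (σ * windowPerm h (α⁻¹ * β)) = inv σ := by
  rw [(hk.mul_windowPerm h β).inv_eq, hk.inv_eq, hinv]
  congr 1
  set ρ := windowPerm h (α⁻¹ * β)
  refine Finset.card_equiv (ρ.prodCongr ρ) ?_
  rintro ⟨p, q⟩
  rw [Finset.mem_filter, Finset.mem_filter]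
  simp only [Finset.mem_univ, true_and, Equiv.prodCongr_apply, Prod.map_apply,
    Equiv.Perm.mul_apply]
  have hp := windowPerm_mem_iff h (α⁻¹ * β) p
  have hq := windowPerm_mem_iff h (α⁻¹ * β) q
  rw [hp, hq]
  refine and_congr_left fun hout => and_congr_left fun _ => ?_
  rw [Fin.lt_def, Fin.lt_def]
  by_cases hp' : k ≤ (p : ℕ) ∧ (p : ℕ) < k + j
  · have e : ρ q = q := windowPerm_apply_of_notMem h _ fun hq' => hout ⟨hp', hq'⟩
    have hp2 := hp.mpr hp'
    have hq2 : ¬ (k ≤ (q : ℕ) ∧ (q : ℕ) < k + j) := fun hq' => hout ⟨hp', hq'⟩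
    rw [e]
    change _ ↔ (windowPerm h (α⁻¹ * β) p : ℕ) < _
    omega
  · have e : ρ p = p := windowPerm_apply_of_notMem h _ hp'
    rw [e]
    change _ ↔ _ < (windowPerm h (α⁻¹ * β) q : ℕ)
    by_cases hq' : k ≤ (q : ℕ) ∧ (q : ℕ) < k + j
    · have hq2 := hq.mpr hq'
      omega
    · rw [windowPerm_apply_of_notMem h _ hq']

/-- Permutations having no `α`-match before position `k` and no `β`-match after it. -/
def Mixed {j : ℕ} (α β : Equiv.Perm (Fin j)) (k : ℕ) {m : ℕ} (σ : Equiv.Perm (Fin m)) : Prop :=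
  (∀ l < k, ¬ MatchAt α σ l) ∧ ∀ l, k < l → ¬ MatchAt β σ l

theorem Mixed.mul_windowPerm {j m k : ℕ} (h : k + j ≤ m) {α β γ δ : Equiv.Perm (Fin j)}
    (hα : MinAtEnds α) (hβ : MinAtEnds β) (hγ : MinAtEnds γ) (hδ : MinAtEnds δ)
    {σ : Equiv.Perm (Fin m)} (hk : MatchAt γ σ k) (hσ : Mixed α β k σ) :
    Mixed α β k (σ * windowPerm h (γ⁻¹ * δ)) := by
  have hk' := hk.mul_windowPerm h δ
  have hback : σ * windowPerm h (γ⁻¹ * δ) * windowPerm h (δ⁻¹ * γ) = σ := by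
    rw [mul_assoc, windowPerm_mul_cancel h (by group), mul_one]
  refine ⟨fun l hl hm => hσ.1 l hl ?_, fun l hl hm => hσ.2 l hl ?_⟩
  · rw [← hback]
    exact hk'.mul_windowPerm_of_ne h hδ hγ hα hm (by omega)
  · rw [← hback]
    exact hk'.mul_windowPerm_of_ne h hδ hγ hβ hm (by omega)

theorem sum_mixed_matchAt {R : Type*} [CommRing R] {j : ℕ} {α β : Equiv.Perm (Fin j)}
    (hα : MinAtEnds α) (hβ : MinAtEnds β) (hdes : des α = des β) (hinv : inv α = inv β)
    (x q : R) (k m : ℕ) :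
    ∑ σ : Equiv.Perm (Fin m) with Mixed α β k σ ∧ MatchAt α σ k, x ^ des σ * q ^ inv σ =
      ∑ σ : Equiv.Perm (Fin m) with Mixed α β k σ ∧ MatchAt β σ k, x ^ des σ * q ^ inv σ := by
  by_cases h : k + j ≤ m
  · refine Finset.sum_bij' (fun σ _ => σ * windowPerm h (α⁻¹ * β))
      (fun σ _ => σ * windowPerm h (β⁻¹ * α)) ?_ ?_ ?_ ?_ ?_
    · intro σ hσ
      simp only [Finset.mem_filter, Finset.mem_univ, true_and] at hσ ⊢
      exact ⟨hσ.1.mul_windowPerm h hα hβ hα hβ hσ.2, hσ.2.mul_windowPerm h β⟩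
    · intro σ hσ
      simp only [Finset.mem_filter, Finset.mem_univ, true_and] at hσ ⊢
      exact ⟨hσ.1.mul_windowPerm h hα hβ hβ hα hσ.2, hσ.2.mul_windowPerm h α⟩
    · intro σ _
      rw [mul_assoc, windowPerm_mul_cancel h (by group), mul_one]
    · intro σ _
      rw [mul_assoc, windowPerm_mul_cancel h (by group), mul_one]
    · intro σ hσ
      simp only [Finset.mem_filter, Finset.mem_univ, true_and] at hσ
      rw [hσ.2.des_mul_windowPerm h hα hβ hdes, hσ.2.inv_mul_windowPerm h hinv]
  · have hno : ∀ (τ : Equiv.Perm (Fin j)) (σ : Equiv.Perm (Fin m)), ¬ MatchAt τ σ k :=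
      fun _ _ hm => h hm.1
    simp [hno]

theorem sum_mixed_not_matchAt {R : Type*} [CommRing R] {j : ℕ} {α β : Equiv.Perm (Fin j)}
    (hα : MinAtEnds α) (hβ : MinAtEnds β) (hdes : des α = des β) (hinv : inv α = inv β)
    (x q : R) (k m : ℕ) :
    ∑ σ : Equiv.Perm (Fin m) with Mixed α β k σ ∧ ¬ MatchAt α σ k, x ^ des σ * q ^ inv σ =
      ∑ σ : Equiv.Perm (Fin m) with Mixed α β k σ ∧ ¬ MatchAt β σ k, x ^ des σ * q ^ inv σ := by
  have hsplit : ∀ τ : Equiv.Perm (Fin j),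
      ∑ σ : Equiv.Perm (Fin m) with Mixed α β k σ ∧ MatchAt τ σ k, x ^ des σ * q ^ inv σ +
        ∑ σ : Equiv.Perm (Fin m) with Mixed α β k σ ∧ ¬ MatchAt τ σ k, x ^ des σ * q ^ inv σ =
      ∑ σ : Equiv.Perm (Fin m) with Mixed α β k σ, x ^ des σ * q ^ inv σ := by
    intro τ
    rw [← Finset.filter_filter, ← Finset.filter_filter, Finset.sum_filter_add_sum_filter_not]
  have := (hsplit α).trans (hsplit β).symm
  rw [sum_mixed_matchAt hα hβ hdes hinv] at this
  exact add_left_cancel this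

theorem mem_NM_iff {j m : ℕ} (hj : 0 < j) (τ : Equiv.Perm (Fin j)) (σ : Equiv.Perm (Fin m)) :
    σ ∈ NM m τ ↔ ∀ l, ¬ MatchAt τ σ l := by
  simp only [NM, mch, Finset.mem_filter, Finset.mem_univ, true_and, Finset.card_eq_zero,
    Finset.filter_eq_empty_iff, Finset.mem_range]
  refine ⟨fun H l hl => H ?_ hl, fun H l _ => H l⟩
  have := hl.1
  omega

theorem sum_NM_eq {R : Type*} [CommRing R] {j : ℕ} (hj : 0 < j) {α β : Equiv.Perm (Fin j)}
    (hα : MinAtEnds α) (hβ : MinAtEnds β) (hdes : des α = des β) (hinv : inv α = inv β)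
    (x q : R) (m : ℕ) :
    ∑ σ ∈ NM m α, x ^ des σ * q ^ inv σ = ∑ σ ∈ NM m β, x ^ des σ * q ^ inv σ := by
  have key : ∀ k, ∑ σ : Equiv.Perm (Fin m) with Mixed α β k σ ∧ ¬ MatchAt β σ k,
      x ^ des σ * q ^ inv σ = ∑ σ ∈ NM m β, x ^ des σ * q ^ inv σ := by
    intro k
    induction k with
    | zero =>
      refine Finset.sum_congr (Finset.ext fun σ => ?_) fun _ _ => rfl
      rw [mem_NM_iff hj, Finset.mem_filter]
      simp only [Finset.mem_univ, true_and, Mixed]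
      constructor
      · rintro ⟨⟨-, h1⟩, h2⟩ l
        rcases Nat.eq_zero_or_pos l with rfl | hl
        · exact h2
        · exact h1 l hl
      · exact fun H => ⟨⟨fun l hl => absurd hl (by omega), fun l _ => H l⟩, H 0⟩
    | succ k ih =>
      rw [← ih, ← sum_mixed_not_matchAt hα hβ hdes hinv x q k]
      refine Finset.sum_congr (Finset.ext fun σ => ?_) fun _ _ => rfl
      rw [Finset.mem_filter, Finset.mem_filter]
      simp only [Finset.mem_univ, true_and, Mixed]
      constructor
      · rintro ⟨⟨h1, h2⟩, h3⟩
        refine ⟨⟨fun l hl => h1 l (by omega), fun l hl => ?_⟩, h1 k (by omega)⟩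
        rcases Nat.eq_or_lt_of_le (Nat.succ_le_of_lt hl) with rfl | hl'
        · exact h3
        · exact h2 l hl'
      · rintro ⟨⟨h1, h2⟩, h3⟩
        refine ⟨⟨fun l hl => ?_, fun l hl => h2 l (by omega)⟩, h2 _ (by omega)⟩
        rcases Nat.eq_or_lt_of_le (Nat.le_of_lt_succ hl) with rfl | hl'
        · exact h3
        · exact h1 l hl'
  rw [← key m]
  refine Finset.sum_congr (Finset.ext fun σ => ?_) fun _ _ => rfl
  rw [mem_NM_iff hj, Finset.mem_filter]
  simp only [Finset.mem_univ, true_and, Mixed]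
  constructor
  · intro H
    refine ⟨⟨fun l _ => H l, fun l hl hm => ?_⟩, fun hm => ?_⟩ <;>
    · have := hm.1
      omega
  · rintro ⟨⟨h1, -⟩, -⟩ l hm
    have := hm.1
    exact h1 l (by omega) hm

/-- Theorem: for every `T ⊆ {1,…,n}` the permutation `σ^T ∈ S_{3n+2}` exists, the
`σ^T` are pairwise distinct for distinct `T`, and any two of them are
(des,inv)-c-Wilf equivalent: for all `m ≥ 0`,
`Σ_{σ∈NM_m(σ^T)} x^{des σ} q^{inv σ} = Σ_{σ∈NM_m(σ^{T'})} x^{des σ} q^{inv σ}` as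
polynomials in `x` (= `X 0`) and `q` (= `X 1`).  In particular the
(des,inv)-c-Wilf equivalence class of `σ^∅` has size at least `2^n`. -/
theorem stmt19 (n : ℕ) (hn : 1 ≤ n) :
    (∀ T : Finset ℕ, T ⊆ Finset.Icc 1 n →
      ∃ π : Equiv.Perm (Fin (3 * n + 2)), SigmaTSpec n T π) ∧
    (∀ T T' : Finset ℕ, T ⊆ Finset.Icc 1 n → T' ⊆ Finset.Icc 1 n →
      ∀ π π' : Equiv.Perm (Fin (3 * n + 2)),
        SigmaTSpec n T π → SigmaTSpec n T' π' →
          (T ≠ T' → π ≠ π') ∧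
          ∀ m : ℕ,
            (∑ σ ∈ NM m π,
              (MvPolynomial.X 0 : MvPolynomial (Fin 2) ℚ) ^ des σ *
                MvPolynomial.X 1 ^ inv σ) =
            ∑ σ ∈ NM m π',
              (MvPolynomial.X 0 : MvPolynomial (Fin 2) ℚ) ^ des σ *
                MvPolynomial.X 1 ^ inv σ) := by
  refine ⟨fun T _ => exists_sigmaTSpec n T, fun T T' hT hT' π π' h h' => ⟨?_, fun m => ?_⟩⟩
  · rintro hne rfl
    exact hne (h.index_eq hT hT' h')
  · exact sum_NM_eq (by omega) h.minAtEnds h'.minAtEnds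
      ((h.des_eq hn).trans (h'.des_eq hn).symm) (h.inv_eq.trans h'.inv_eq.symm) _ _ m

end CWilf
end
end
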